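/- arXiv:1705.05777 — 5 statements merged into one kernel-verified Lean document; each statement's English description precedes it below -/
import Mathlib

section
/- For a real-valued random variable X with E|X| < \infty, the distance variance satisfies V^2(X) \le \Delta^2(X), where \Delta(X) = E|X - X'| is Gini's mean difference for an independent copy X' of X. -/
open MeasureTheory

/-- The characteristic function of a law `μ` on `ℝ`. -/
noncomputable def charF (μ : Measure ℝ) (t : ℝ) : ℂ :=
  ∫ x, Complex.exp ((t * x : ℝ) * Complex.I) ∂μ

/-- The distance variance of a real random variable with law `μ`, defined via the
characteristic-function integral `V²(X) = π⁻² ∬ |f(s+t) - f(s)f(t)|² / (s²t²) ds dt`. -/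
noncomputable def distVar (μ : Measure ℝ) : ℝ :=
  (1 / Real.pi ^ 2) *
    ∫ q : ℝ × ℝ, ‖charF μ (q.1 + q.2) - charF μ q.1 * charF μ q.2‖ ^ 2 / (q.1 ^ 2 * q.2 ^ 2)

lemma h_integrable : Integrable (fun s : ℝ => (1 - Real.cos s) / s ^ 2) := by
  refine (integrable_inv_one_add_sq.const_mul (5/2)).mono'
    (by apply Measurable.aestronglyMeasurable; fun_prop) ?_
  refine Filter.Eventually.of_forall fun s => ?_
  have hc := Real.cos_le_one s
  have hc' := Real.neg_one_le_cos s
  rw [Real.norm_of_nonneg (by apply div_nonneg <;> nlinarith [sq_nonneg s])]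
  rcases eq_or_ne s 0 with rfl | hs
  · norm_num
  · have h2 : 0 < s ^ 2 := by positivity
    rw [← div_eq_mul_inv, div_le_div_iff₀ h2 (by positivity)]
    have := Real.one_sub_sq_div_two_le_cos (x := s)
    nlinarith

lemma inner_y (s : ℝ) (hs : 0 < s) :
    ∫ y in Set.Ioi (0:ℝ), (1 - Real.cos s) * (y * Real.exp (-(s * y)))
      = (1 - Real.cos s) / s ^ 2 := by
  have := Real.integral_rpow_mul_exp_neg_mul_Ioi (a := 2) (r := s) (by norm_num) hs
  norm_num at this
  rw [integral_const_mul, this]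
  field_simp

lemma inner_y_int (s : ℝ) (hs : 0 < s) :
    IntegrableOn (fun y => (1 - Real.cos s) * (y * Real.exp (-(s * y)))) (Set.Ioi (0:ℝ)) := by
  apply Integrable.const_mul
  apply Integrable.of_integral_ne_zero
  have := Real.integral_rpow_mul_exp_neg_mul_Ioi (a := 2) (r := s) (by norm_num) hs
  norm_num at this
  rw [this]
  positivity

lemma inner_s (y : ℝ) (hy : 0 < y) :
    ∫ s in Set.Ioi (0:ℝ), (1 - Real.cos s) * (y * Real.exp (-(s * y)))
      = (1 + y ^ 2)⁻¹ := by
  have ha : ((-y : ℂ) + Complex.I).re < 0 := by simpa using hy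
  have hb : ((-y : ℂ)).re < 0 := by simpa using hy
  have i1 := integrableOn_exp_mul_complex_Ioi ha 0
  have i2 := integrableOn_exp_mul_complex_Ioi hb 0
  have e1 := integral_exp_mul_complex_Ioi ha 0
  have e2 := integral_exp_mul_complex_Ioi hb 0
  have e3 := integral_sub i2 i1
  rw [e1, e2] at e3
  have e4 := congrArg (fun z : ℂ => y * z.re) e3
  have e5 : (∫ s in Set.Ioi (0:ℝ), (Complex.exp (-y * s) - Complex.exp ((-y + Complex.I) * s))).re
      = ∫ s in Set.Ioi (0:ℝ), (Complex.exp (-y * s) - Complex.exp ((-y + Complex.I) * s)).re :=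
    (integral_re (𝕜 := ℂ) (i2.sub i1)).symm
  rw [e5, ← integral_const_mul] at e4
  convert! e4 using 1
  · congr 1
    ext s
    rw [Complex.sub_re, Complex.exp_re, Complex.exp_re]
    simp
    ring_nf
  · have : y ≠ 0 := hy.ne'
    simp [Complex.div_re, Complex.normSq_apply]
    field_simp
    ring

lemma h_integral_Ioi : ∫ s in Set.Ioi (0:ℝ), (1 - Real.cos s) / s ^ 2 = Real.pi / 2 := by
  have hF : Integrable (Function.uncurry fun s y : ℝ => (1 - Real.cos s) * (y * Real.exp (-(s * y))))
      ((volume.restrict (Set.Ioi (0:ℝ))).prod (volume.restrict (Set.Ioi (0:ℝ)))) := by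
    rw [integrable_prod_iff (by
      apply Continuous.aestronglyMeasurable; unfold Function.uncurry; fun_prop)]
    constructor
    · exact (ae_restrict_mem measurableSet_Ioi).mono fun s hs => inner_y_int s hs
    · refine (h_integrable.integrableOn (s := Set.Ioi 0)).congr ?_
      refine (ae_restrict_mem measurableSet_Ioi).mono fun s hs => ?_
      simp only [Function.uncurry]
      rw [← inner_y s hs]
      refine setIntegral_congr_fun measurableSet_Ioi fun y hy => ?_
      have hy' : (0:ℝ) < y := hy
      have hc := Real.cos_le_one s
      exact (Real.norm_of_nonneg (mul_nonneg (by linarith) (by positivity))).symm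
  have hsw := integral_integral_swap hF
  rw [setIntegral_congr_fun measurableSet_Ioi (fun s hs => inner_y s hs),
    setIntegral_congr_fun measurableSet_Ioi (fun s hs => inner_s s hs)] at hsw
  rw [hsw, integral_Ioi_inv_one_add_sq]
  simp

lemma h_integral : ∫ s : ℝ, (1 - Real.cos s) / s ^ 2 = Real.pi := by
  have := integral_comp_abs (f := fun s : ℝ => (1 - Real.cos s) / s ^ 2)
  simp only [Real.cos_abs, sq_abs] at this
  rw [this, h_integral_Ioi]
  ring

lemma h_scale (u s : ℝ) : (1 - Real.cos (s * u)) / s ^ 2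
    = u ^ 2 * ((1 - Real.cos (s * u)) / (s * u) ^ 2) := by
  rcases eq_or_ne u 0 with rfl | hu
  · simp
  · rcases eq_or_ne s 0 with rfl | hs
    · simp
    · field_simp

lemma k_integrable (u : ℝ) : Integrable (fun s : ℝ => (1 - Real.cos (s * u)) / s ^ 2) := by
  rcases eq_or_ne u 0 with rfl | hu
  · simp
  · simp_rw [h_scale u]
    exact (h_integrable.comp_mul_right' hu).const_mul _

lemma k_integral (u : ℝ) : ∫ s : ℝ, (1 - Real.cos (s * u)) / s ^ 2 = Real.pi * |u| := by
  rcases eq_or_ne u 0 with rfl | hu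
  · simp
  · simp_rw [h_scale u]
    rw [integral_const_mul,
      Measure.integral_comp_mul_right (fun s : ℝ => (1 - Real.cos s) / s ^ 2) u, h_integral,
      smul_eq_mul, abs_inv, ← sq_abs u]
    have : |u| ≠ 0 := abs_ne_zero.mpr hu
    field_simp

lemma e_integrable (μ : Measure ℝ) [IsProbabilityMeasure μ] (t : ℝ) :
    Integrable (fun x : ℝ => Complex.exp ((t * x : ℝ) * Complex.I)) μ := by
  refine Integrable.of_bound (by fun_prop) 1 (Filter.Eventually.of_forall fun x => ?_)
  rw [Complex.norm_exp_ofReal_mul_I]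

lemma charF_norm_sq (μ : Measure ℝ) [IsProbabilityMeasure μ] (s : ℝ) :
    1 - ‖charF μ s‖ ^ 2 = ∫ q : ℝ × ℝ, (1 - Real.cos (s * (q.1 - q.2))) ∂(μ.prod μ) := by
  have hint : Integrable (fun q : ℝ × ℝ => Complex.exp ((s * q.1 : ℝ) * Complex.I) *
      (starRingEnd ℂ) (Complex.exp ((s * q.2 : ℝ) * Complex.I))) (μ.prod μ) := by
    refine Integrable.of_bound (by fun_prop) 1 (Filter.Eventually.of_forall fun x => ?_)
    rw [norm_mul, RCLike.norm_conj, Complex.norm_exp_ofReal_mul_I, Complex.norm_exp_ofReal_mul_I]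
    norm_num
  have h1 := integral_prod_mul (μ := μ) (ν := μ) (fun x : ℝ => Complex.exp ((s * x : ℝ) * Complex.I))
    (fun x : ℝ => (starRingEnd ℂ) (Complex.exp ((s * x : ℝ) * Complex.I)))
  rw [integral_conj] at h1
  change _ = charF μ s * (starRingEnd ℂ) (charF μ s) at h1
  rw [Complex.mul_conj] at h1
  have h2 := congrArg Complex.re h1
  have h3 := integral_re (𝕜 := ℂ) hint
  simp only [RCLike.re_to_complex] at h3
  rw [← h3, Complex.ofReal_re, Complex.normSq_eq_norm_sq] at h2
  have h4 : ∀ q : ℝ × ℝ, (Complex.exp ((s * q.1 : ℝ) * Complex.I) *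
      (starRingEnd ℂ) (Complex.exp ((s * q.2 : ℝ) * Complex.I))).re
      = Real.cos (s * (q.1 - q.2)) := fun q => by
    rw [Complex.mul_re, Complex.conj_re, Complex.conj_im, Complex.exp_ofReal_mul_I_re,
      Complex.exp_ofReal_mul_I_re, Complex.exp_ofReal_mul_I_im, Complex.exp_ofReal_mul_I_im,
      mul_sub, Real.cos_sub]
    ring
  simp_rw [h4] at h2
  rw [← h2, integral_sub (integrable_const _)]
  · simp
  · refine Integrable.of_bound (by fun_prop) 1 (Filter.Eventually.of_forall fun x => ?_)
    exact Real.abs_cos_le_one _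

lemma centered_sq (μ : Measure ℝ) [IsProbabilityMeasure μ] (s : ℝ) :
    ∫ x, ‖Complex.exp ((s * x : ℝ) * Complex.I) - charF μ s‖ ^ 2 ∂μ = 1 - ‖charF μ s‖ ^ 2 := by
  have h : ∀ x : ℝ, ‖Complex.exp ((s * x : ℝ) * Complex.I) - charF μ s‖ ^ 2
      = 1 + ‖charF μ s‖ ^ 2 -
        2 * (Complex.exp ((s * x : ℝ) * Complex.I) * (starRingEnd ℂ) (charF μ s)).re := fun x => by
    rw [← Complex.normSq_eq_norm_sq, Complex.normSq_sub, Complex.normSq_eq_norm_sq,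
      Complex.norm_exp_ofReal_mul_I, Complex.normSq_eq_norm_sq]
    norm_num
  have hi := (e_integrable μ s).mul_const ((starRingEnd ℂ) (charF μ s))
  have h3 := integral_re (𝕜 := ℂ) hi
  simp only [RCLike.re_to_complex] at h3
  have hre : Integrable (fun x : ℝ =>
    (Complex.exp ((s * x : ℝ) * Complex.I) * (starRingEnd ℂ) (charF μ s)).re) μ := hi.re
  simp_rw [h]
  rw [integral_sub (integrable_const _) (hre.const_mul 2), integral_const_mul, h3,
    integral_mul_const]
  change _ - 2 * (charF μ s * (starRingEnd ℂ) (charF μ s)).re = _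
  rw [Complex.mul_conj, Complex.ofReal_re, Complex.normSq_eq_norm_sq]
  simp
  ring

lemma cs_bound (μ : Measure ℝ) [IsProbabilityMeasure μ] (s t : ℝ) :
    ‖charF μ (s + t) - charF μ s * charF μ t‖ ^ 2
      ≤ (1 - ‖charF μ s‖ ^ 2) * (1 - ‖charF μ t‖ ^ 2) := by
  set a : ℝ → ℂ := fun x => Complex.exp ((s * x : ℝ) * Complex.I) - charF μ s with ha
  set b : ℝ → ℂ := fun x => Complex.exp ((t * x : ℝ) * Complex.I) - charF μ t with hb
  have hA : ∫ x, ‖a x‖ ^ 2 ∂μ = 1 - ‖charF μ s‖ ^ 2 := centered_sq μ s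
  have hB : ∫ x, ‖b x‖ ^ 2 ∂μ = 1 - ‖charF μ t‖ ^ 2 := centered_sq μ t
  have na : ∀ x, ‖a x‖ ≤ 1 + ‖charF μ s‖ := fun x =>
    (norm_sub_le _ _).trans (by rw [Complex.norm_exp_ofReal_mul_I])
  have nb : ∀ x, ‖b x‖ ≤ 1 + ‖charF μ t‖ := fun x =>
    (norm_sub_le _ _).trans (by rw [Complex.norm_exp_ofReal_mul_I])
  have ca : Continuous a := by fun_prop
  have cb : Continuous b := by fun_prop
  have iA : Integrable (fun x => ‖a x‖ ^ 2) μ := by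
    refine Integrable.of_bound (by fun_prop) ((1 + ‖charF μ s‖) ^ 2)
      (Filter.Eventually.of_forall fun x => ?_)
    rw [Real.norm_of_nonneg (by positivity)]
    gcongr; exact na x
  have iB : Integrable (fun x => ‖b x‖ ^ 2) μ := by
    refine Integrable.of_bound (by fun_prop) ((1 + ‖charF μ t‖) ^ 2)
      (Filter.Eventually.of_forall fun x => ?_)
    rw [Real.norm_of_nonneg (by positivity)]
    gcongr; exact nb x
  have iC : Integrable (fun x => ‖a x‖ * ‖b x‖) μ := by
    refine Integrable.of_bound (by fun_prop) ((1 + ‖charF μ s‖) * (1 + ‖charF μ t‖))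
      (Filter.Eventually.of_forall fun x => ?_)
    rw [Real.norm_of_nonneg (by positivity)]
    gcongr
    · exact na x
    · exact nb x
  have hab : charF μ (s + t) - charF μ s * charF μ t = ∫ x, a x * b x ∂μ := by
    have h : ∀ x, a x * b x = Complex.exp (((s + t) * x : ℝ) * Complex.I)
        - charF μ t * Complex.exp ((s * x : ℝ) * Complex.I)
        - charF μ s * Complex.exp ((t * x : ℝ) * Complex.I) + charF μ s * charF μ t := fun x => by
      have : Complex.exp (((s + t) * x : ℝ) * Complex.I) = Complex.exp ((s * x : ℝ) * Complex.I)
          * Complex.exp ((t * x : ℝ) * Complex.I) := by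
        rw [← Complex.exp_add]; push_cast; ring_nf
      rw [this, ha, hb]; ring
    simp_rw [h]
    have i1 := e_integrable μ (s + t)
    have i2 := (e_integrable μ s).const_mul (charF μ t)
    have i3 := (e_integrable μ t).const_mul (charF μ s)
    have i4 : Integrable (fun x : ℝ => Complex.exp (((s + t) * x : ℝ) * Complex.I)
        - charF μ t * Complex.exp ((s * x : ℝ) * Complex.I)) μ := i1.sub i2
    have i5 : Integrable (fun x : ℝ => Complex.exp (((s + t) * x : ℝ) * Complex.I)
        - charF μ t * Complex.exp ((s * x : ℝ) * Complex.I)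
        - charF μ s * Complex.exp ((t * x : ℝ) * Complex.I)) μ := i4.sub i3
    rw [integral_add i5 (integrable_const _), integral_sub i4 i3,
      integral_sub i1 i2, integral_const_mul, integral_const_mul]
    change _ = charF μ (s + t) - charF μ t * charF μ s - charF μ s * charF μ t + _
    simp
    ring
  have hC : ‖charF μ (s + t) - charF μ s * charF μ t‖ ≤ ∫ x, ‖a x‖ * ‖b x‖ ∂μ := by
    rw [hab]
    refine (norm_integral_le_integral_norm _).trans_eq ?_
    simp_rw [norm_mul]
  have hq : ∀ r : ℝ, 0 ≤ (∫ x, ‖a x‖ ^ 2 ∂μ) * (r * r) + (-2 * ∫ x, ‖a x‖ * ‖b x‖ ∂μ) * r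
      + ∫ x, ‖b x‖ ^ 2 ∂μ := fun r => by
    have h0 : 0 ≤ ∫ x, (r * r) * ‖a x‖ ^ 2 + (-2 * r) * (‖a x‖ * ‖b x‖) + ‖b x‖ ^ 2 ∂μ :=
      integral_nonneg fun x => by
        have := sq_nonneg (r * ‖a x‖ - ‖b x‖)
        simp only [Pi.zero_apply]
        linarith
    have i6 : Integrable (fun x => (r * r) * ‖a x‖ ^ 2 + (-2 * r) * (‖a x‖ * ‖b x‖)) μ :=
      (iA.const_mul _).add (iC.const_mul _)
    rw [integral_add i6 iB,
      integral_add (iA.const_mul _) (iC.const_mul _), integral_const_mul, integral_const_mul] at h0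
    linarith
  have hd := discrim_le_zero hq
  rw [discrim, hA, hB] at hd
  have := pow_le_pow_left₀ (norm_nonneg _) hC 2
  linarith

lemma F_integrable (μ : Measure ℝ) [IsProbabilityMeasure μ]
    (h1 : Integrable (fun x => |x|) μ) :
    Integrable (Function.uncurry fun (s : ℝ) (q : ℝ × ℝ) =>
      (1 - Real.cos (s * (q.1 - q.2))) / s ^ 2) (volume.prod (μ.prod μ)) := by
  have hx : Integrable (fun x : ℝ => x) μ := by
    rw [← integrable_norm_iff (by fun_prop)]; exact h1
  have hd : Integrable (fun q : ℝ × ℝ => q.1 - q.2) (μ.prod μ) :=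
    (hx.comp_fst μ).sub (hx.comp_snd μ)
  rw [integrable_prod_iff' (by
    apply Measurable.aestronglyMeasurable; unfold Function.uncurry; fun_prop)]
  constructor
  · exact Filter.Eventually.of_forall fun q => k_integrable (q.1 - q.2)
  · refine (hd.abs.const_mul Real.pi).congr (Filter.Eventually.of_forall fun q => ?_)
    simp only [Function.uncurry]
    rw [← k_integral]
    congr 1
    ext s
    have := Real.cos_le_one (s * (q.1 - q.2))
    exact (Real.norm_of_nonneg (div_nonneg (by linarith) (by positivity))).symm

/-- For a real random variable `X` with law `μ` and `E|X| < ∞`, the distance variance is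
bounded above by the square of Gini's mean difference `Δ(X) = E|X - X'|`. -/
theorem distVar_le_gini_sq (μ : Measure ℝ) [IsProbabilityMeasure μ]
    (h1 : Integrable (fun x => |x|) μ) :
    distVar μ ≤ (∫ q, |q.1 - q.2| ∂(μ.prod μ)) ^ 2 := by
  have hF := F_integrable μ h1
  have hg : ∀ s : ℝ, ∫ q : ℝ × ℝ, (1 - Real.cos (s * (q.1 - q.2))) / s ^ 2 ∂(μ.prod μ)
      = (1 - ‖charF μ s‖ ^ 2) / s ^ 2 := fun s => by
    rw [integral_div, charF_norm_sq]
  have hgi : Integrable (fun s : ℝ => (1 - ‖charF μ s‖ ^ 2) / s ^ 2) :=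
    hF.integral_prod_left.congr (Filter.Eventually.of_forall hg)
  have hgv : ∫ s : ℝ, (1 - ‖charF μ s‖ ^ 2) / s ^ 2
      = Real.pi * ∫ q, |q.1 - q.2| ∂(μ.prod μ) := by
    have := integral_integral_swap hF
    simp_rw [hg, k_integral] at this
    rw [this, integral_const_mul]
  have hmono : (∫ q : ℝ × ℝ, ‖charF μ (q.1 + q.2) - charF μ q.1 * charF μ q.2‖ ^ 2
        / (q.1 ^ 2 * q.2 ^ 2))
      ≤ ∫ q : ℝ × ℝ, ((1 - ‖charF μ q.1‖ ^ 2) / q.1 ^ 2) * ((1 - ‖charF μ q.2‖ ^ 2) / q.2 ^ 2) := by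
    refine integral_mono_of_nonneg (Filter.Eventually.of_forall fun q => by positivity)
      (hgi.mul_prod hgi) (Filter.Eventually.of_forall fun q => ?_)
    simp only []
    rw [div_mul_div_comm]
    gcongr
    exact cs_bound μ q.1 q.2
  rw [Measure.volume_eq_prod, integral_prod_mul (fun s : ℝ => (1 - ‖charF μ s‖ ^ 2) / s ^ 2)
    (fun s : ℝ => (1 - ‖charF μ s‖ ^ 2) / s ^ 2), hgv, ← Measure.volume_eq_prod] at hmono
  unfold distVar
  rw [one_div, inv_mul_le_iff₀ (by positivity)]
  linarith
end

section
/- Let X be a real-valued random variable with cdf F and E|X| < \infty. Then the distance variance satisfies V^2(X) = 8 \int\int_{x < y} F(x)^2 (1 - F(y))^2 dx dy. -/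
open MeasureTheory
open Filter Topology FourierTransform ENNReal
open scoped SchwartzMap ContDiff

abbrev E2 := WithLp 2 (ℝ × ℝ)

noncomputable abbrev L2E := Lp (α := E2) ℂ 2 volume

lemma fourier_toLp_ae (f : E2 → ℂ) (hf : Integrable f) (hf2 : MemLp f 2) :
    ((𝓕 (hf2.toLp f) : L2E) : E2 → ℂ) =ᵐ[volume] 𝓕 f := by
  have hc : Continuous (𝓕 f) :=
    VectorFourier.fourierIntegral_continuous Real.continuous_fourierChar
      (L := innerₗ E2) continuous_inner hf
  apply ae_eq_of_integral_contDiff_smul_eq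
  · exact (Lp.memLp _).locallyIntegrable (by norm_num)
  · exact hc.locallyIntegrable
  · intro g g_smooth g_cpt
    have hg₁ : HasCompactSupport (Complex.ofRealCLM ∘ g) := g_cpt.comp_left rfl
    have hg₂ : ContDiff ℝ ∞ (Complex.ofRealCLM ∘ g) := by fun_prop
    set G := hg₁.toSchwartzMap hg₂ with hG
    have h1 := congrArg (fun T => T G) (Lp.fourier_toTemperedDistribution_eq (hf2.toLp f))
    simp only [TemperedDistribution.fourier_apply, Lp.toTemperedDistribution_apply] at h1
    have h2 : ∫ x, g x • (𝓕 (hf2.toLp f) : L2E) x = ∫ x, G x • (𝓕 (hf2.toLp f) : L2E) x := by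
      simp [hG]
    have h3 : ∫ x, g x • 𝓕 f x = ∫ x, G x • 𝓕 f x := by
      simp [hG]
    rw [h2, h3, ← h1]
    have h4 : ∫ x, (𝓕 G) x • hf2.toLp f x = ∫ x, 𝓕 (G : E2 → ℂ) x • f x := by
      apply integral_congr_ae
      filter_upwards [hf2.coeFn_toLp] with x hx
      rw [hx, SchwartzMap.fourier_coe]
    rw [h4]
    simpa using! VectorFourier.integral_fourierIntegral_smul_eq_flip (L := innerₗ E2)
      Real.continuous_fourierChar continuous_inner G.integrable hf

lemma Lp_norm_sq (f : L2E) : ‖f‖ ^ 2 = ∫ x, ‖f x‖ ^ 2 := by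
  have := (L2.inner_def (𝕜 := ℂ) f f)
  rw [inner_self_eq_norm_sq_to_K] at this
  apply Complex.ofRealLI.injective
  simpa [← LinearIsometry.integral_comp_comm, inner_self_eq_norm_sq_to_K] using this

lemma plancherel_limit (h g : E2 → ℂ) (hn : ℕ → E2 → ℂ) (hh : MemLp h 2)
    (hInt : ∀ n, Integrable (hn n)) (hle : ∀ n x, ‖hn n x‖ ≤ ‖h x‖)
    (hlim : ∀ x, Tendsto (fun n => hn n x) atTop (𝓝 (h x)))
    (hF : ∀ᵐ x, Tendsto (fun n => 𝓕 (hn n) x) atTop (𝓝 (g x))) :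
    ∫ x, ‖g x‖ ^ 2 = ∫ x, ‖h x‖ ^ 2 := by
  have hn2 : ∀ n, MemLp (hn n) 2 := fun n =>
    hh.mono (hInt n).1 (Eventually.of_forall (hle n))
  have hconv : Tendsto (fun n => (hn2 n).toLp (hn n)) atTop (𝓝 (hh.toLp h)) := by
    rw [Lp.tendsto_Lp_iff_tendsto_eLpNorm'']
    have h0 : Tendsto (fun n => ∫⁻ x, ‖(hn n - h) x‖ₑ ^ (2:ℝ)) atTop (𝓝 0) := by
      have key := tendsto_lintegral_of_dominated_convergence' (μ := (volume : Measure E2))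
        (F := fun n x => ‖(hn n - h) x‖ₑ ^ (2:ℝ)) (f := fun _ => 0)
        (fun x => ‖2 * h x‖ₑ ^ (2:ℝ))
        (fun n => (((hInt n).1.sub hh.1).enorm.pow_const _))
        (fun n => Eventually.of_forall fun x => ?_) ?_ (Eventually.of_forall fun x => ?_)
      · simpa using key
      · refine ENNReal.rpow_le_rpow ?_ (by norm_num)
        calc ‖(hn n - h) x‖ₑ ≤ ‖hn n x‖ₑ + ‖h x‖ₑ := enorm_sub_le
          _ ≤ ‖h x‖ₑ + ‖h x‖ₑ := by gcongr; exact enorm_le_iff_norm_le.2 (hle n x)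
          _ = 2 * ‖h x‖ₑ := by ring
          _ = _ := by rw [enorm_mul]; simp [enorm_eq_nnnorm]
      · have := lintegral_rpow_enorm_lt_top_of_eLpNorm_lt_top (by norm_num) (by norm_num) (hh.const_mul 2).2
        simpa using this.ne
      · have : Tendsto (fun n => ‖hn n x - h x‖ₑ) atTop (𝓝 0) := by
          have := (((hlim x).sub_const (h x))).enorm
          simpa using this
        have := (ENNReal.continuous_rpow_const (y := 2)).tendsto _ |>.comp this
        simpa using! this
    have := (ENNReal.continuous_rpow_const (y := 1/2)).tendsto _ |>.comp h0
    simp_rw [eLpNorm_eq_lintegral_rpow_enorm_toReal (two_ne_zero) (ENNReal.ofNat_ne_top)]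
    simpa using! this
  have hconvF : Tendsto (fun n => (𝓕 ((hn2 n).toLp (hn n)) : L2E)) atTop
      (𝓝 (𝓕 (hh.toLp h))) :=
    ((Lp.fourierTransformₗᵢ E2 ℂ).continuous.tendsto _).comp hconv
  obtain ⟨ns, hns, hae⟩ := (tendstoInMeasure_of_tendsto_Lp hconvF).exists_seq_tendsto_ae
  have hall : ∀ᵐ x, ∀ n, (𝓕 ((hn2 n).toLp (hn n)) : L2E) x = 𝓕 (hn n) x :=
    ae_all_iff.2 fun n => fourier_toLp_ae _ (hInt n) (hn2 n)
  have hgeq : ∀ᵐ x, g x = (𝓕 (hh.toLp h) : L2E) x := by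
    filter_upwards [hae, hall, hF] with x h1 h2 h3
    simp_rw [h2] at h1
    exact tendsto_nhds_unique (h3.comp hns.tendsto_atTop) h1
  calc ∫ x, ‖g x‖ ^ 2 = ∫ x, ‖(𝓕 (hh.toLp h) : L2E) x‖ ^ 2 := by
        apply integral_congr_ae
        filter_upwards [hgeq] with x hx
        rw [hx]
    _ = ‖hh.toLp h‖ ^ 2 := by rw [← Lp_norm_sq, Lp.norm_fourier_eq]
    _ = ∫ x, ‖h x‖ ^ 2 := by
        rw [Lp_norm_sq]
        apply integral_congr_ae
        filter_upwards [hh.coeFn_toLp] with x hx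
        rw [hx]

/-- cdf -/
noncomputable def cF (μ : Measure ℝ) (x : ℝ) : ℝ := (μ (Set.Iic x)).toReal

/-- the Hoeffding kernel -/
noncomputable def HK (μ : Measure ℝ) (q : ℝ × ℝ) : ℝ :=
  cF μ (min q.1 q.2) - cF μ q.1 * cF μ q.2

/-- the exponential -/
noncomputable def ex (s x : ℝ) : ℂ := Complex.exp ((s * x : ℝ) * Complex.I)

lemma norm_ex (s x : ℝ) : ‖ex s x‖ = 1 := Complex.norm_exp_ofReal_mul_I _

lemma continuous_ex (s : ℝ) : Continuous (ex s) := by unfold ex; fun_prop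

set_option linter.unusedSectionVars false

section
variable (μ : Measure ℝ) [IsProbabilityMeasure μ]

lemma cF_mono : Monotone (cF μ) := fun _ _ h =>
  ENNReal.toReal_mono (measure_ne_top _ _) (measure_mono (Set.Iic_subset_Iic.2 h))

lemma cF_nonneg (x : ℝ) : 0 ≤ cF μ x := ENNReal.toReal_nonneg

lemma cF_le_one (x : ℝ) : cF μ x ≤ 1 := by
  have := prob_le_one (μ := μ) (s := Set.Iic x)
  exact ENNReal.toReal_le_of_le_ofReal (by norm_num) (by simpa using this)

lemma measurable_cF : Measurable (cF μ) := (cF_mono μ).measurable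

lemma measurable_HK : Measurable (HK μ) := by
  have := measurable_cF μ
  unfold HK
  fun_prop

lemma HK_of_le {x y : ℝ} (h : x ≤ y) : HK μ (x, y) = cF μ x * (1 - cF μ y) := by
  simp only [HK, min_eq_left h]; ring

lemma HK_symm (x y : ℝ) : HK μ (x, y) = HK μ (y, x) := by
  simp only [HK, min_comm x y]; ring

lemma HK_nonneg (q : ℝ × ℝ) : 0 ≤ HK μ q := by
  obtain ⟨x, y⟩ := q
  have key : ∀ x y, x ≤ y → 0 ≤ HK μ (x, y) := fun x y h => by
    rw [HK_of_le μ h]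
    exact mul_nonneg (cF_nonneg _ _) (sub_nonneg.2 (cF_le_one _ _))
  rcases le_total x y with h | h
  · exact key _ _ h
  · rw [HK_symm]; exact key _ _ h

lemma HK_sq_le (q : ℝ × ℝ) :
    HK μ q ^ 2 ≤ (cF μ q.1 * (1 - cF μ q.1)) * (cF μ q.2 * (1 - cF μ q.2)) := by
  obtain ⟨x, y⟩ := q
  have key : ∀ x y, x ≤ y → HK μ (x, y) ^ 2 ≤
      (cF μ x * (1 - cF μ x)) * (cF μ y * (1 - cF μ y)) := fun x y h => by
    rw [HK_of_le μ h]
    have h1 := cF_mono μ h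
    have h2 := cF_nonneg μ x
    have h3 := cF_le_one μ y
    have h4 : cF μ x * (1 - cF μ y) ≤ cF μ y * (1 - cF μ x) := by nlinarith
    have h5 : 0 ≤ cF μ x * (1 - cF μ y) := mul_nonneg h2 (by linarith)
    nlinarith
  rcases le_total x y with h | h
  · exact key _ _ h
  · rw [HK_symm]; have := key _ _ h; simp only; linarith

lemma integrable_k (h1 : Integrable (fun x => |x|) μ) :
    Integrable (fun x => cF μ x * (1 - cF μ x)) := by
  have hm : Measurable (fun x => cF μ x * (1 - cF μ x)) := by
    have := measurable_cF μ; fun_prop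
  have hle : ∀ x, ‖cF μ x * (1 - cF μ x)‖ₑ ≤ μ {z | |x| ≤ |z|} := by
    intro x
    have h0 := cF_nonneg μ x
    have h2 := cF_le_one μ x
    have hk : cF μ x * (1 - cF μ x) ≤ (μ {z | |x| ≤ |z|}).toReal := by
      rcases le_total x 0 with hx | hx
      · have : cF μ x ≤ (μ {z | |x| ≤ |z|}).toReal := by
          refine ENNReal.toReal_mono (measure_ne_top _ _) (measure_mono fun z hz => ?_)
          simp only [Set.mem_Iic, Set.mem_ofPred_eq] at hz ⊢
          rw [abs_of_nonpos hx, abs_of_nonpos (hz.trans hx)]; linarith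
        nlinarith
      · have : 1 - cF μ x ≤ (μ {z | |x| ≤ |z|}).toReal := by
          have : 1 - cF μ x = (μ (Set.Iic x)ᶜ).toReal := by
            rw [prob_compl_eq_one_sub measurableSet_Iic,
              ENNReal.toReal_sub_of_le prob_le_one (by simp)]
            simp [cF]
          rw [this]
          refine ENNReal.toReal_mono (measure_ne_top _ _) (measure_mono fun z hz => ?_)
          simp only [Set.mem_compl_iff, Set.mem_Iic, not_le, Set.mem_ofPred_eq] at hz ⊢
          rw [abs_of_nonneg hx, abs_of_nonneg (hx.trans hz.le)]; exact hz.le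
        nlinarith
    rw [Real.enorm_of_nonneg (mul_nonneg h0 (by linarith))]
    exact ENNReal.ofReal_le_of_le_toReal hk
  refine ⟨hm.aestronglyMeasurable, ?_⟩
  have hS : MeasurableSet {p : ℝ × ℝ | |p.1| ≤ |p.2|} :=
    measurableSet_le (by fun_prop) (by fun_prop)
  calc ∫⁻ x, ‖cF μ x * (1 - cF μ x)‖ₑ ≤ ∫⁻ x, μ {z | |x| ≤ |z|} := lintegral_mono hle
    _ = ((volume : Measure ℝ).prod μ) {p : ℝ × ℝ | |p.1| ≤ |p.2|} :=
        (Measure.prod_apply hS).symm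
    _ = ∫⁻ z, volume {x : ℝ | |x| ≤ |z|} ∂μ := Measure.prod_apply_symm hS
    _ = ∫⁻ z, 2 * ‖|z|‖ₑ ∂μ := by
        congr 1; ext z
        have : {x : ℝ | |x| ≤ |z|} = Set.Icc (-|z|) (|z|) := by ext x; simp [abs_le]
        rw [this, Real.volume_Icc, Real.enorm_of_nonneg (abs_nonneg z), sub_neg_eq_add, ← two_mul,
          ENNReal.ofReal_mul (by norm_num)]
        simp
    _ < ⊤ := by
        rw [lintegral_const_mul' _ _ (by simp)]
        exact ENNReal.mul_lt_top (by simp) h1.2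

lemma integrable_HK_sq (h1 : Integrable (fun x => |x|) μ) :
    Integrable (fun q => HK μ q ^ 2) := by
  refine ((integrable_k μ h1).mul_prod (integrable_k μ h1)).mono'
    ((measurable_HK μ).pow_const 2).aestronglyMeasurable (Eventually.of_forall fun q => ?_)
  rw [Real.norm_of_nonneg (sq_nonneg _)]
  exact HK_sq_le μ q

lemma integral_HK_sq (h1 : Integrable (fun x => |x|) μ) :
    ∫ q, HK μ q ^ 2 = 2 * ∫ q in {q : ℝ × ℝ | q.1 < q.2},
        (μ (Set.Iic q.1)).toReal ^ 2 * (1 - (μ (Set.Iic q.2)).toReal) ^ 2 := by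
  have hi := integrable_HK_sq μ h1
  have hS : MeasurableSet {q : ℝ × ℝ | q.1 < q.2} := measurableSet_lt measurable_fst measurable_snd
  have hS' : MeasurableSet {q : ℝ × ℝ | q.1 ≤ q.2} := measurableSet_le measurable_fst measurable_snd
  have hlt : ∫ q in {q : ℝ × ℝ | q.1 < q.2}, HK μ q ^ 2 = ∫ q in {q : ℝ × ℝ | q.1 < q.2},
        (μ (Set.Iic q.1)).toReal ^ 2 * (1 - (μ (Set.Iic q.2)).toReal) ^ 2 := by
    refine setIntegral_congr_fun hS fun q hq => ?_
    obtain ⟨x, y⟩ := q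
    simp only [HK_of_le μ (le_of_lt hq), cF]; ring
  have hdiag : (volume : Measure (ℝ × ℝ)) {q : ℝ × ℝ | q.1 = q.2} = 0 := by
    rw [Measure.volume_eq_prod, Measure.prod_apply (measurableSet_eq_fun measurable_fst measurable_snd)]
    have : ∀ x : ℝ, (Prod.mk x ⁻¹' {q : ℝ × ℝ | q.1 = q.2}) = {x} := fun x => by
      ext y; simp [eq_comm]
    simp [this]
  have hc : ∫ q in {q : ℝ × ℝ | q.1 < q.2}ᶜ, HK μ q ^ 2
      = ∫ q in {q : ℝ × ℝ | q.1 < q.2}, HK μ q ^ 2 := by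
    have e1 : ({q : ℝ × ℝ | q.1 < q.2}ᶜ : Set (ℝ × ℝ)) =ᵐ[volume] {q : ℝ × ℝ | q.2 < q.1} := by
      have : ∀ᵐ q : ℝ × ℝ, ¬ q.1 = q.2 := by
        rw [ae_iff]; simpa using hdiag
      filter_upwards [this] with q hq
      apply propext
      change ¬ (q.1 < q.2) ↔ q.2 < q.1
      constructor
      · intro h; exact lt_of_le_of_ne (not_lt.1 h) (Ne.symm hq)
      · intro h; exact not_lt.2 h.le
    rw [setIntegral_congr_set e1]
    have := (Measure.measurePreserving_swap (μ := (volume : Measure ℝ)) (ν := (volume : Measure ℝ))).setIntegral_preimage_emb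
      MeasurableEquiv.prodComm.measurableEmbedding (fun q => HK μ q ^ 2) {q : ℝ × ℝ | q.1 < q.2}
    rw [← Measure.volume_eq_prod] at this
    rw [← this]
    refine setIntegral_congr_fun (measurableSet_lt measurable_snd measurable_fst) fun q hq => ?_
    obtain ⟨x, y⟩ := q
    simp only [Prod.swap, HK_symm μ x y]
  rw [← integral_add_compl hS hi, hc, hlt]; ring
end

/-- truncated integrand -/
noncomputable def av (n : ℕ) (s : ℝ) (x z : ℝ) : ℂ :=
  (Set.Ioc (-(n : ℝ)) n).indicator (ex s) x * (Set.Ici z).indicator 1 x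

/-- clamp -/
noncomputable def cl (n : ℕ) (z : ℝ) : ℝ := max (-(n : ℝ)) (min z n)

lemma continuous_cl (n : ℕ) : Continuous (cl n) := by unfold cl; fun_prop

lemma integral_av (n : ℕ) (s : ℝ) (hs : s ≠ 0) (z : ℝ) :
    ∫ x, av n s x z = (ex s n - ex s (cl n z)) / (s * Complex.I) := by
  have hn : (0 : ℝ) ≤ n := Nat.cast_nonneg n
  have hcl : cl n z ≤ n := max_le (by linarith) (min_le_right _ _)
  have e1 : (fun x => av n s x z) =ᵐ[volume] (Set.Ioc (cl n z) n).indicator (ex s) := by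
    have : ∀ᵐ x : ℝ, x ≠ z := by simp [ae_iff]
    filter_upwards [this] with x hx
    by_cases h : x ∈ Set.Ioc (cl n z) n
    · have h1 : x ∈ Set.Ioc (-(n : ℝ)) n := ⟨(le_max_left _ _).trans_lt h.1, h.2⟩
      have h2 : x ∈ Set.Ici z := by
        have := (le_max_right _ _).trans_lt h.1
        rcases min_lt_iff.1 this with h3 | h3
        · exact h3.le
        · exact absurd h.2 (not_le.2 h3)
      simp [av, h, h1, h2, -Set.mem_Ioc, -Set.mem_Ici]
    · rw [Set.indicator_of_notMem h]
      by_cases h1 : x ∈ Set.Ioc (-(n : ℝ)) n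
      · have h2 : x ∉ Set.Ici z := fun h3 => h ⟨max_lt h1.1 (min_lt_of_left_lt
          (lt_of_le_of_ne h3 (Ne.symm hx))), h1.2⟩
        simp [av, h2, -Set.mem_Ici]
      · simp [av, h1, -Set.mem_Ioc]
  rw [integral_congr_ae e1, integral_indicator measurableSet_Ioc,
    ← intervalIntegral.integral_of_le hcl]
  have hc : (s * Complex.I : ℂ) ≠ 0 := by simp [hs]
  have := integral_exp_mul_complex (a := cl n z) (b := n) hc
  have e2 : ∀ x : ℝ, ex s x = Complex.exp (s * Complex.I * x) := fun x => by
    unfold ex; push_cast; ring_nf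
  simp_rw [e2]
  exact this

lemma measurable_av (n : ℕ) (s : ℝ) : Measurable (fun p : ℝ × ℝ => av n s p.1 p.2) := by
  have h1 : Measurable ((Set.Ioc (-(n : ℝ)) n).indicator (ex s)) :=
    (continuous_ex s).measurable.indicator measurableSet_Ioc
  have h2 : Measurable (fun p : ℝ × ℝ => (Set.Ici p.2).indicator (1 : ℝ → ℂ) p.1) := by
    have : (fun p : ℝ × ℝ => (Set.Ici p.2).indicator (1 : ℝ → ℂ) p.1)
        = {p : ℝ × ℝ | p.2 ≤ p.1}.indicator 1 := by
      ext p; simp [Set.indicator_apply]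
    rw [this]
    exact measurable_one.indicator (measurableSet_le measurable_snd measurable_fst)
  exact (h1.comp measurable_fst).mul h2

/-- indicator of the interval -/
noncomputable def iv (n : ℕ) : ℝ → ℝ := (Set.Ioc (-(n : ℝ)) n).indicator 1

lemma integrable_iv (n : ℕ) : Integrable (iv n) := by
  unfold iv
  rw [integrable_indicator_iff measurableSet_Ioc]
  exact integrableOn_const (by simp) (by simp)

lemma norm_av_le (n : ℕ) (s x z : ℝ) : ‖av n s x z‖ ≤ iv n x := by
  unfold av iv
  rw [norm_mul]
  by_cases h1 : x ∈ Set.Ioc (-(n : ℝ)) n <;> by_cases h2 : x ∈ Set.Ici z <;>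
    simp [h1, h2, norm_ex, -Set.mem_Ioc, -Set.mem_Ici]

section
variable (μ : Measure ℝ) [IsProbabilityMeasure μ]

lemma integral_ind (x : ℝ) : ∫ z, (Set.Ici z).indicator (1 : ℝ → ℂ) x ∂μ = cF μ x := by
  have : (fun z => (Set.Ici z).indicator (1 : ℝ → ℂ) x) = (Set.Iic x).indicator (fun _ => (1:ℂ)) := by
    ext z; simp [Set.indicator_apply]
  rw [this, integral_indicator measurableSet_Iic]
  simp [cF, Measure.real]

lemma integral_ind2 (x y : ℝ) : ∫ z, (Set.Ici z).indicator (1 : ℝ → ℂ) x *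
    (Set.Ici z).indicator (1 : ℝ → ℂ) y ∂μ = cF μ (min x y) := by
  rw [← integral_ind]
  congr 1; ext z
  by_cases h1 : z ≤ x <;> by_cases h2 : z ≤ y <;> simp [Set.indicator_apply, h1, h2]

lemma trunc_one (n : ℕ) (s : ℝ) :
    ∫ x, (Set.Ioc (-(n : ℝ)) n).indicator (ex s) x * cF μ x = ∫ z, (∫ x, av n s x z) ∂μ := by
  rw [← integral_integral_swap]
  · congr 1; ext x
    simp only [av]
    rw [integral_const_mul, integral_ind]
  · refine ((integrable_iv n).mul_prod (integrable_const (1 : ℝ) (μ := μ))).mono'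
      (measurable_av n s).aestronglyMeasurable (Eventually.of_forall fun p => ?_)
    simpa [Function.uncurry] using norm_av_le n s p.1 p.2

lemma trunc_two (n : ℕ) (s t : ℝ) :
    ∫ p : ℝ × ℝ, (Set.Ioc (-(n : ℝ)) n).indicator (ex s) p.1 *
      (Set.Ioc (-(n : ℝ)) n).indicator (ex t) p.2 * cF μ (min p.1 p.2)
      = ∫ z, (∫ x, av n s x z) * (∫ y, av n t y z) ∂μ := by
  simp_rw [← integral_prod_mul]
  rw [← integral_integral_swap]
  · rw [← Measure.volume_eq_prod]
    congr 1; ext p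
    rw [← integral_ind2, ← integral_const_mul]
    congr 1; ext z
    simp only [av]; ring
  · refine (((integrable_iv n).mul_prod (integrable_iv n)).mul_prod
      (integrable_const (1 : ℝ) (μ := μ))).mono' ?_ (Eventually.of_forall fun p => ?_)
    · exact (((measurable_av n s).comp (f := fun p : (ℝ × ℝ) × ℝ => (p.1.1, p.2)) (by fun_prop)).mul
        ((measurable_av n t).comp (f := fun p : (ℝ × ℝ) × ℝ => (p.1.2, p.2)) (by fun_prop))).aestronglyMeasurable
    · simp only [Function.uncurry, norm_mul, mul_one]
      exact mul_le_mul (norm_av_le _ _ _ _) (norm_av_le _ _ _ _) (norm_nonneg _)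
        ((norm_nonneg _).trans (norm_av_le n s p.1.1 p.2))

lemma integrable_bdd (f : ℝ → ℂ) (hf : Measurable f) (h : ∀ x, ‖f x‖ ≤ 1) : Integrable f μ :=
  (integrable_const (1 : ℝ)).mono' hf.aestronglyMeasurable (Eventually.of_forall h)

/-- square indicator -/
def sqn (n : ℕ) : Set (ℝ × ℝ) := Set.Ioc (-(n : ℝ)) n ×ˢ Set.Ioc (-(n : ℝ)) n

lemma measurableSet_sqn (n : ℕ) : MeasurableSet (sqn n) := measurableSet_Ioc.prod measurableSet_Ioc

lemma trunc_cov (n : ℕ) (s t : ℝ) (hs : s ≠ 0) (ht : t ≠ 0) :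
    ∫ p : ℝ × ℝ, ex s p.1 * ex t p.2 * (sqn n).indicator (fun p => (HK μ p : ℂ)) p
      = (∫ z, ex s (cl n z) * ex t (cl n z) ∂μ -
        (∫ z, ex s (cl n z) ∂μ) * (∫ z, ex t (cl n z) ∂μ)) / ((s * Complex.I) * (t * Complex.I)) := by
  have hmcF := measurable_cF μ
  have e0 : ∀ p : ℝ × ℝ, ex s p.1 * ex t p.2 * (sqn n).indicator (fun p => (HK μ p : ℂ)) p
      = (Set.Ioc (-(n : ℝ)) n).indicator (ex s) p.1 *
      (Set.Ioc (-(n : ℝ)) n).indicator (ex t) p.2 * cF μ (min p.1 p.2) -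
        ((Set.Ioc (-(n : ℝ)) n).indicator (ex s) p.1 * cF μ p.1) *
        ((Set.Ioc (-(n : ℝ)) n).indicator (ex t) p.2 * cF μ p.2) := by
    intro p
    by_cases h1 : p.1 ∈ Set.Ioc (-(n : ℝ)) n <;> by_cases h2 : p.2 ∈ Set.Ioc (-(n : ℝ)) n
    · have : p ∈ sqn n := ⟨h1, h2⟩
      simp only [h1, h2, this, Set.indicator_of_mem, HK]; push_cast; ring
    all_goals
      have : p ∉ sqn n := fun h => by first | exact h1 h.1 | exact h2 h.2
      simp [h1, h2, this, -Set.mem_Ioc]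
  have hmi : ∀ s, Measurable ((Set.Ioc (-(n : ℝ)) n).indicator (ex s)) := fun s =>
    (continuous_ex s).measurable.indicator measurableSet_Ioc
  have hbi : ∀ s x, ‖(Set.Ioc (-(n : ℝ)) n).indicator (ex s) x‖ ≤ iv n x := fun s x => by
    unfold iv
    by_cases h1 : x ∈ Set.Ioc (-(n : ℝ)) n <;> simp [h1, norm_ex, -Set.mem_Ioc]
  have hcb : ∀ x, ‖(cF μ x : ℂ)‖ ≤ 1 := fun x => by
    rw [Complex.norm_real, Real.norm_of_nonneg (cF_nonneg _ _)]; exact cF_le_one _ _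
  have hbi2 : ∀ s x, ‖(Set.Ioc (-(n : ℝ)) n).indicator (ex s) x * cF μ x‖ ≤ iv n x := fun s x => by
    rw [norm_mul]
    exact (mul_le_of_le_one_right (norm_nonneg _) (hcb _)).trans (hbi _ _)
  have hIone : ∀ s, Integrable (fun x => (Set.Ioc (-(n : ℝ)) n).indicator (ex s) x * (cF μ x : ℂ)) :=
    fun s => (integrable_iv n).mono'
      ((hmi s).mul (Complex.measurable_ofReal.comp hmcF)).aestronglyMeasurable
      (Eventually.of_forall (hbi2 s))
  simp_rw [e0]
  rw [integral_sub]
  · rw [trunc_two, Measure.volume_eq_prod, integral_prod_mul (fun x => (Set.Ioc (-(n : ℝ)) n).indicator (ex s) x * (cF μ x : ℂ))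
      (fun x => (Set.Ioc (-(n : ℝ)) n).indicator (ex t) x * (cF μ x : ℂ)), trunc_one, trunc_one]
    simp_rw [integral_av n s hs, integral_av n t ht]
    have hi : ∀ s, Integrable (fun z => ex s (cl n z)) μ := fun s =>
      integrable_bdd μ _ ((continuous_ex s).comp (continuous_cl n)).measurable
        (fun x => (norm_ex _ _).le)
    have hi2 : Integrable (fun z => ex s (cl n z) * ex t (cl n z)) μ :=
      integrable_bdd μ _ (((continuous_ex s).comp (continuous_cl n)).mul
        ((continuous_ex t).comp (continuous_cl n))).measurable
        (fun x => by simp [norm_ex])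
    have e1 : ∀ s : ℝ, ∫ z, (ex s n - ex s (cl n z)) / (s * Complex.I) ∂μ
        = (ex s n - ∫ z, ex s (cl n z) ∂μ) / (s * Complex.I) := fun s => by
      rw [integral_div, integral_sub (integrable_const _) (hi s)]; simp
    have e2 : ∫ z, (ex s n - ex s (cl n z)) / (s * Complex.I) *
        ((ex t n - ex t (cl n z)) / (t * Complex.I)) ∂μ
        = (ex s n * ex t n - ex s n * ∫ z, ex t (cl n z) ∂μ - ex t n * ∫ z, ex s (cl n z) ∂μ
          + ∫ z, ex s (cl n z) * ex t (cl n z) ∂μ) / ((s * Complex.I) * (t * Complex.I)) := by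
      rw [← integral_const_mul, ← integral_const_mul]
      have : ∀ z, (ex s n - ex s (cl n z)) / (s * Complex.I) *
        ((ex t n - ex t (cl n z)) / (t * Complex.I)) = (ex s n * ex t n - ex s n * ex t (cl n z) - ex t n * ex s (cl n z)
          + ex s (cl n z) * ex t (cl n z)) / ((s * Complex.I) * (t * Complex.I)) := fun z => by
        rw [div_mul_div_comm]; congr 1; ring
      simp_rw [this]
      rw [integral_div, integral_add _ hi2, integral_sub _ ((hi s).const_mul _),
        integral_sub (integrable_const _) ((hi t).const_mul _)]
      · simp
      · exact (integrable_const _).sub ((hi t).const_mul _)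
      · exact ((integrable_const _).sub ((hi t).const_mul _)).sub ((hi s).const_mul _)
    rw [e1, e1, e2, div_mul_div_comm, ← sub_div]
    congr 1; ring
  · refine ((integrable_iv n).mul_prod (integrable_iv n)).mono' ?_ (Eventually.of_forall fun p => ?_)
    · have := hmi s; have := hmi t
      exact Measurable.aestronglyMeasurable (by fun_prop)
    · rw [norm_mul, norm_mul]
      refine (mul_le_of_le_one_right (by positivity) (hcb _)).trans ?_
      exact mul_le_mul (hbi _ _) (hbi _ _) (norm_nonneg _) ((norm_nonneg _).trans (hbi s _))
  · exact (hIone s).mul_prod (hIone t)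

lemma cl_eventually (z : ℝ) : ∀ᶠ n : ℕ in atTop, cl n z = z := by
  filter_upwards [eventually_ge_atTop ⌈|z|⌉₊] with n hn
  have : |z| ≤ n := (Nat.le_ceil _).trans (by exact_mod_cast hn)
  have := abs_le.1 this
  simp [cl, this.1, this.2]

lemma tendsto_cl (f : ℝ → ℂ) (hf : Continuous f) (hb : ∀ x, ‖f x‖ ≤ 1) :
    Tendsto (fun n => ∫ z, f (cl n z) ∂μ) atTop (𝓝 (∫ z, f z ∂μ)) := by
  refine tendsto_integral_of_dominated_convergence (fun _ => (1 : ℝ))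
    (fun n => (hf.comp (continuous_cl n)).measurable.aestronglyMeasurable) (integrable_const _)
    (fun n => Eventually.of_forall fun x => hb _) (Eventually.of_forall fun z => ?_)
  refine tendsto_const_nhds.congr' ?_
  filter_upwards [cl_eventually z] with n hn
  rw [hn]

/-- limit function -/
noncomputable def gl (q : ℝ × ℝ) : ℂ :=
  (charF μ (q.1 + q.2) - charF μ q.1 * charF μ q.2) / ((q.1 * Complex.I) * (q.2 * Complex.I))

lemma tendsto_gl (s t : ℝ) (hs : s ≠ 0) (ht : t ≠ 0) :
    Tendsto (fun n => ∫ p : ℝ × ℝ, ex s p.1 * ex t p.2 * (sqn n).indicator (fun p => (HK μ p : ℂ)) p)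
      atTop (𝓝 (gl μ (s, t))) := by
  simp_rw [trunc_cov μ _ s t hs ht]
  have e : ∫ z, ex s z * ex t z ∂μ = charF μ (s + t) := by
    unfold charF ex
    congr 1; ext z; rw [← Complex.exp_add]; congr 1; push_cast; ring
  have := tendsto_cl μ (fun z => ex s z * ex t z) ((continuous_ex s).mul (continuous_ex t))
    (fun x => by simp [norm_ex])
  rw [e] at this
  exact (this.sub ((tendsto_cl μ (ex s) (continuous_ex s) (fun x => (norm_ex _ _).le)).mul
    (tendsto_cl μ (ex t) (continuous_ex t) (fun x => (norm_ex _ _).le)))).div_const _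

lemma norm_gl_sq (q : ℝ × ℝ) : ‖gl μ q‖ ^ 2 =
    ‖charF μ (q.1 + q.2) - charF μ q.1 * charF μ q.2‖ ^ 2 / (q.1 ^ 2 * q.2 ^ 2) := by
  simp [gl, div_pow, mul_pow]

end

lemma fourier_E2 (f : ℝ × ℝ → ℂ) (w : E2) :
    𝓕 (fun x : E2 => f (WithLp.ofLp x)) w =
      ∫ p : ℝ × ℝ, ex (-(2 * Real.pi) * (WithLp.ofLp w).1) p.1 *
        ex (-(2 * Real.pi) * (WithLp.ofLp w).2) p.2 * f p := by
  rw [Real.fourier_eq']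
  rw [← (WithLp.volume_preserving_ofLp ℝ ℝ).integral_comp
    (MeasurableEquiv.toLp 2 (ℝ × ℝ)).symm.measurableEmbedding]
  congr 1; ext v
  rw [smul_eq_mul]
  congr 1
  unfold ex
  rw [← Complex.exp_add]
  congr 1
  rw [WithLp.prod_inner_apply]
  simp
  ring

lemma main_plancherel (μ : Measure ℝ) [IsProbabilityMeasure μ]
    (h1 : Integrable (fun x => |x|) μ) :
    ∫ q : ℝ × ℝ, ‖gl μ ((-(2 * Real.pi)) • q)‖ ^ 2 = ∫ q, HK μ q ^ 2 := by
  have hmp := WithLp.volume_preserving_ofLp ℝ ℝ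
  have hme : MeasurableEmbedding (@WithLp.ofLp 2 (ℝ × ℝ)) :=
    (MeasurableEquiv.toLp 2 (ℝ × ℝ)).symm.measurableEmbedding
  have hmH : Measurable (fun p => (HK μ p : ℂ)) := Complex.measurable_ofReal.comp (measurable_HK μ)
  have hmem : MemLp (fun p => (HK μ p : ℂ)) 2 := by
    rw [memLp_two_iff_integrable_sq_norm hmH.aestronglyMeasurable]
    simpa using integrable_HK_sq μ h1
  have key := plancherel_limit (fun x : E2 => (HK μ (WithLp.ofLp x) : ℂ))
    (fun x : E2 => gl μ ((-(2 * Real.pi)) • (WithLp.ofLp x)))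
    (fun n x => (sqn n).indicator (fun p => (HK μ p : ℂ)) (WithLp.ofLp x))
    (hmem.comp_measurePreserving hmp) ?_ ?_ ?_ ?_
  · rw [hmp.integral_comp hme (fun q => ‖gl μ ((-(2 * Real.pi)) • q)‖ ^ 2),
      hmp.integral_comp hme (fun q => ‖(HK μ q : ℂ)‖ ^ 2)] at key
    simpa using key
  · intro n
    refine hmp.integrable_comp_of_integrable (g := (sqn n).indicator (fun p => (HK μ p : ℂ))) ?_
    rw [integrable_indicator_iff (measurableSet_sqn n)]
    have : IsFiniteMeasure ((volume : Measure (ℝ × ℝ)).restrict (sqn n)) := by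
      constructor
      simp only [Measure.restrict_apply_univ, sqn, Measure.volume_eq_prod, Measure.prod_prod,
        Real.volume_Ioc]
      exact ENNReal.mul_lt_top (by simp) (by simp)
    exact (hmem.restrict _).integrable (by norm_num)
  · intro n x
    exact norm_indicator_le_norm_self _ _
  · intro x
    refine tendsto_const_nhds.congr' ?_
    generalize WithLp.ofLp x = p
    filter_upwards [eventually_gt_atTop ⌈|p.1|⌉₊, eventually_gt_atTop ⌈|p.2|⌉₊] with n hn hm
    have a1 : |p.1| < n := (Nat.le_ceil _).trans_lt (by exact_mod_cast hn)
    have a2 : |p.2| < n := (Nat.le_ceil _).trans_lt (by exact_mod_cast hm)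
    have b1 := abs_lt.1 a1
    have b2 := abs_lt.1 a2
    have : p ∈ sqn n := ⟨⟨b1.1, b1.2.le⟩, ⟨b2.1, b2.2.le⟩⟩
    rw [Set.indicator_of_mem this]
  · have hz : ∀ᵐ q : ℝ × ℝ, q.1 ≠ 0 ∧ q.2 ≠ 0 := by
      have h0 : ∀ᵐ x : ℝ, x ≠ 0 := by simp [ae_iff]
      exact (Measure.quasiMeasurePreserving_fst.ae h0).and
        (Measure.quasiMeasurePreserving_snd.ae h0)
    filter_upwards [hmp.quasiMeasurePreserving.ae hz] with x hx
    simp_rw [fourier_E2]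
    have hpi : -(2 * Real.pi) ≠ 0 := by simp [Real.pi_ne_zero]
    exact tendsto_gl μ _ _ (mul_ne_zero hpi hx.1) (mul_ne_zero hpi hx.2)

/-- For a real random variable `X` with cdf `F` and `E|X| < ∞`,
`V²(X) = 8 ∬_{x<y} F(x)² (1-F(y))² dx dy`. -/
theorem distVar_cdf_rep (μ : Measure ℝ) [IsProbabilityMeasure μ]
    (h1 : Integrable (fun x => |x|) μ) :
    distVar μ =
      8 * ∫ q in {q : ℝ × ℝ | q.1 < q.2},
        (μ (Set.Iic q.1)).toReal ^ 2 * (1 - (μ (Set.Iic q.2)).toReal) ^ 2 := by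
  have h2 := main_plancherel μ h1
  rw [Measure.integral_comp_smul volume (fun q => ‖gl μ q‖ ^ 2), integral_HK_sq μ h1] at h2
  simp_rw [norm_gl_sq] at h2
  have hfin : Module.finrank ℝ (ℝ × ℝ) = 2 := by simp
  rw [hfin, smul_eq_mul, abs_of_nonneg (by positivity)] at h2
  unfold distVar
  have hpi := Real.pi_ne_zero
  field_simp at h2 ⊢
  linarith
end

section
/- Let X, X', X'', X''' be i.i.d. real-valued random variables with E|X| < \infty, and let X_{1:4} \le X_{2:4} \le X_{3:4} \le X_{4:4} be their order statistics. Then the distance variance satisfies V^2(X) = (2/3) E[(X_{3:4} - X_{2:4})^2], i.e., two-thirds of the second moment of the central spacing of a sample of size four. -/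
open MeasureTheory

/-- The second order statistic of four reals (the second smallest), expressed as the
minimum over all pairs of the pairwise maxima. -/
noncomputable def ostat2of4 (a b c d : ℝ) : ℝ :=
  min (min (max a b) (max a c)) (min (max a d) (min (max b c) (min (max b d) (max c d))))

/-- The third order statistic of four reals (the second largest), expressed as the
maximum over all pairs of the pairwise minima. -/
noncomputable def ostat3of4 (a b c d : ℝ) : ℝ :=
  max (max (min a b) (min a c)) (max (min a d) (max (min b c) (max (min b d) (min c d))))

open Set

noncomputable def psi (u s : ℝ) : ℝ := (1 - Real.cos (s * u)) / s ^ 2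

lemma psi_nonneg (u s : ℝ) : 0 ≤ psi u s :=
  div_nonneg (by linarith [Real.cos_le_one (s * u)]) (sq_nonneg s)

lemma psi_measurable : Measurable (fun p : ℝ × ℝ => psi p.1 p.2) := by
  unfold psi; fun_prop

lemma psi_one_le (s : ℝ) : psi 1 s ≤ 4 * (1 + s ^ 2)⁻¹ := by
  unfold psi
  by_cases hs : s = 0
  · subst hs; simp
  have h2 : 0 < s ^ 2 := by positivity
  rw [← div_eq_mul_inv, div_le_div_iff₀ h2 (by positivity), mul_one]
  nlinarith [Real.one_sub_sq_div_two_le_cos (x := s), Real.neg_one_le_cos s]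

lemma psi_one_integrable : Integrable (psi 1) := by
  refine (integrable_inv_one_add_sq.const_mul 4).mono' ?_ ?_
  · exact (psi_measurable.comp (measurable_const.prodMk measurable_id)).aestronglyMeasurable
  · filter_upwards with s
    rw [Real.norm_of_nonneg (psi_nonneg _ _)]; exact psi_one_le s

lemma int_x_exp {s : ℝ} (hs : 0 < s) :
    IntegrableOn (fun x : ℝ => x * Real.exp (-(s * x))) (Ioi 0) ∧
    ∫ x in Ioi (0:ℝ), x * Real.exp (-(s * x)) = 1 / s ^ 2 := by
  have h := Real.integral_rpow_mul_exp_neg_mul_Ioi (a := 2) (r := s) (by norm_num) hs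
  have e : ∫ x in Ioi (0:ℝ), x * Real.exp (-(s * x)) = 1 / s ^ 2 := by
    norm_num at h
    have h' : (1:ℝ) / s ^ 2 = (s ^ 2)⁻¹ := by ring
    rw [h', ← h]
  refine ⟨?_, e⟩
  by_contra hc
  have : ∫ x in Ioi (0:ℝ), x * Real.exp (-(s * x)) = 0 := integral_undef hc
  rw [this] at e
  have : 0 < 1 / s ^ 2 := by positivity
  linarith

lemma int_cos_exp {x : ℝ} (hx : 0 < x) :
    ∫ s in Ioi (0:ℝ), (1 - Real.cos s) * Real.exp (-(s * x)) = 1 / (x * (1 + x ^ 2)) := by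
  have a1 : (-x : ℂ).re < 0 := by simpa using hx
  have a2 : (-x + Complex.I : ℂ).re < 0 := by simpa using hx
  have i1 := integrableOn_exp_mul_complex_Ioi a1 0
  have i2 := integrableOn_exp_mul_complex_Ioi a2 0
  have e1 := integral_exp_mul_complex_Ioi a1 0
  have e2 := integral_exp_mul_complex_Ioi a2 0
  have e3 := integral_sub i1 i2
  rw [e1, e2] at e3
  have e4 := congrArg Complex.re e3
  have i3 := i1.sub i2
  have e5 := integral_re (𝕜 := ℂ) i3
  simp only [Pi.sub_apply, RCLike.re_to_complex] at e5
  rw [← e5] at e4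
  have l : ∀ s : ℝ, (Complex.exp (-x * s) - Complex.exp ((-x + Complex.I) * s)).re
      = (1 - Real.cos s) * Real.exp (-(s * x)) := by
    intro s
    simp [Complex.exp_re]
    ring_nf
  simp only [l] at e4
  rw [e4]
  have : x ^ 2 + 1 ≠ 0 := by positivity
  simp [Complex.div_re, Complex.normSq_apply]
  field_simp
  ring

lemma psi_one_half : ∫ s in Ioi (0:ℝ), psi 1 s = Real.pi / 2 := by
  have hI : Integrable (fun p : ℝ × ℝ => (1 - Real.cos p.1) * (p.2 * Real.exp (-(p.1 * p.2))))
      ((volume.restrict (Ioi 0)).prod (volume.restrict (Ioi 0))) := by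
    rw [integrable_prod_iff (by apply Measurable.aestronglyMeasurable; fun_prop)]
    constructor
    · filter_upwards [ae_restrict_mem measurableSet_Ioi] with s hs
      exact (int_x_exp hs).1.const_mul _
    · refine (psi_one_integrable.integrableOn (s := Ioi 0)).congr ?_
      filter_upwards [ae_restrict_mem measurableSet_Ioi] with s hs
      have : ∀ x ∈ Ioi (0:ℝ), ‖(1 - Real.cos s) * (x * Real.exp (-(s * x)))‖
          = (1 - Real.cos s) * (x * Real.exp (-(s * x))) := by
        intro x hx
        refine Real.norm_of_nonneg (mul_nonneg (by linarith [Real.cos_le_one s]) ?_)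
        have : (0:ℝ) < x := hx
        positivity
      rw [setIntegral_congr_fun measurableSet_Ioi this, integral_const_mul, (int_x_exp hs).2]
      simp [psi]; ring
  have hs := integral_integral_swap (f := fun s x : ℝ => (1 - Real.cos s) * (x * Real.exp (-(s * x)))) hI
  have l : ∫ s in Ioi (0:ℝ), psi 1 s =
      ∫ s in Ioi (0:ℝ), ∫ x in Ioi (0:ℝ), (1 - Real.cos s) * (x * Real.exp (-(s * x))) := by
    refine setIntegral_congr_fun measurableSet_Ioi fun s hs => ?_
    simp only [integral_const_mul, (int_x_exp hs).2]
    simp [psi]; ring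
  have r : ∫ x in Ioi (0:ℝ), ∫ s in Ioi (0:ℝ), (1 - Real.cos s) * (x * Real.exp (-(s * x)))
      = ∫ x in Ioi (0:ℝ), (1 + x ^ 2)⁻¹ := by
    refine setIntegral_congr_fun measurableSet_Ioi fun x hx => ?_
    have : ∀ s : ℝ, (1 - Real.cos s) * (x * Real.exp (-(s * x)))
      = x * ((1 - Real.cos s) * Real.exp (-(s * x))) := fun s => by ring
    simp only [this, integral_const_mul, int_cos_exp hx]
    have : (0:ℝ) < x := hx
    field_simp
  rw [l, hs, r]
  simp

lemma psi_one_integral : ∫ s, psi 1 s = Real.pi := by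
  have := integral_comp_abs (f := psi 1)
  rw [psi_one_half] at this
  rw [show Real.pi = 2 * (Real.pi / 2) by ring, ← this]
  congr 1; ext s; simp [psi]

lemma psi_scale (u s : ℝ) : psi u s = u ^ 2 * psi 1 (s * u) := by
  unfold psi
  by_cases hu : u = 0
  · simp [hu]
  by_cases hs : s = 0
  · simp [hs]
  field_simp

lemma psi_integrable (u : ℝ) : Integrable (psi u) := by
  by_cases hu : u = 0
  · have : psi u = fun _ => 0 := by ext s; simp [psi, hu]
    rw [this]; exact integrable_zero _ _ _
  · have : psi u = fun s => u ^ 2 * psi 1 (s * u) := by ext s; exact psi_scale u s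
    rw [this]; exact (psi_one_integrable.comp_mul_right' hu).const_mul _

lemma psi_integral (u : ℝ) : ∫ s, psi u s = Real.pi * |u| := by
  simp_rw [psi_scale u, integral_const_mul]
  rw [Measure.integral_comp_mul_right (psi 1), psi_one_integral]
  by_cases hu : u = 0
  · simp [hu]
  · rw [abs_inv, ← sq_abs u]
    have : |u| ≠ 0 := abs_ne_zero.2 hu
    simp only [smul_eq_mul]; field_simp

noncomputable def eF (s x : ℝ) : ℂ := Complex.exp ((s * x : ℝ) * Complex.I)
noncomputable def aF (s : ℝ) (p : ℝ × ℝ) : ℂ := eF s p.1 - eF s p.2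
noncomputable def kF (s : ℝ) (p r : ℝ × ℝ) : ℂ :=
  aF s p * (starRingEnd ℂ) (aF s r) / ((s ^ 2 : ℝ) : ℂ)

lemma eF_re (s x : ℝ) : (eF s x).re = Real.cos (s * x) := by
  unfold eF; rw [Complex.exp_ofReal_mul_I_re]
lemma eF_im (s x : ℝ) : (eF s x).im = Real.sin (s * x) := by
  unfold eF; rw [Complex.exp_ofReal_mul_I_im]

lemma eF_norm (s x : ℝ) : ‖eF s x‖ = 1 := Complex.norm_exp_ofReal_mul_I _

@[fun_prop]
lemma eF_meas : Measurable (fun p : ℝ × ℝ => eF p.1 p.2) := by unfold eF; fun_prop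

@[fun_prop]
lemma aF_meas : Measurable (fun p : ℝ × (ℝ × ℝ) => aF p.1 p.2) := by unfold aF eF; fun_prop

lemma kF_meas : Measurable (fun p : ℝ × (ℝ × ℝ) × (ℝ × ℝ) => kF p.1 p.2.1 p.2.2) := by
  unfold kF aF eF; 
  refine Measurable.div (Measurable.mul (by fun_prop) (Complex.continuous_conj.measurable.comp (by fun_prop))) (by fun_prop)

lemma aF_norm_sq (s : ℝ) (p : ℝ × ℝ) : ‖aF s p‖ ^ 2 = 2 * (1 - Real.cos (s * (p.1 - p.2))) := by
  rw [Complex.sq_norm, Complex.normSq_apply]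
  simp only [aF, Complex.sub_re, Complex.sub_im, eF_re, eF_im, mul_sub, Real.cos_sub]
  nlinarith [Real.sin_sq_add_cos_sq (s * p.1), Real.sin_sq_add_cos_sq (s * p.2)]

lemma aF_psi (s : ℝ) (p : ℝ × ℝ) : ‖aF s p‖ ^ 2 / s ^ 2 = 2 * psi (p.1 - p.2) s := by
  rw [aF_norm_sq, psi]; ring

lemma kF_norm (s : ℝ) (p r : ℝ × ℝ) : ‖kF s p r‖ = ‖aF s p‖ * ‖aF s r‖ / s ^ 2 := by
  simp [kF]

lemma kF_bound (s : ℝ) (p r : ℝ × ℝ) :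
    ‖kF s p r‖ ≤ psi (p.1 - p.2) s + psi (r.1 - r.2) s := by
  have h1 := aF_psi s p
  have h2 := aF_psi s r
  have : ‖kF s p r‖ ≤ (‖aF s p‖ ^ 2 / s ^ 2 + ‖aF s r‖ ^ 2 / s ^ 2) / 2 := by
    rw [kF_norm, ← add_div, div_right_comm]
    gcongr
    nlinarith [sq_nonneg (‖aF s p‖ - ‖aF s r‖)]
  linarith

lemma kF_integrable (p r : ℝ × ℝ) : Integrable (fun s => kF s p r) := by
  refine ((psi_integrable (p.1 - p.2)).add (psi_integrable (r.1 - r.2))).mono' ?_ ?_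
  · exact (kF_meas.comp (f := fun s : ℝ => (s, p, r)) (by fun_prop)).aestronglyMeasurable
  · filter_upwards with s using kF_bound s p r

lemma kF_neg (s : ℝ) (p r : ℝ × ℝ) : kF (-s) p r = (starRingEnd ℂ) (kF s p r) := by
  have h : ∀ x, eF (-s) x = (starRingEnd ℂ) (eF s x) := by
    intro x
    apply Complex.ext
    · simp [eF_re]
    · simp [eF_im]
  simp [kF, aF, h]

lemma kF_re (s : ℝ) (p r : ℝ × ℝ) : (kF s p r).re =
    psi (p.1 - r.2) s + psi (p.2 - r.1) s - psi (p.1 - r.1) s - psi (p.2 - r.2) s := by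
  unfold kF
  rw [Complex.div_ofReal_re]
  simp only [psi, aF, Complex.mul_re, Complex.conj_re, Complex.conj_im, Complex.sub_re,
    Complex.sub_im, eF_re, eF_im, mul_sub, Real.cos_sub]
  ring

noncomputable def hF (p r : ℝ × ℝ) : ℝ := |p.1 - r.2| + |p.2 - r.1| - |p.1 - r.1| - |p.2 - r.2|

lemma kF_integral (p r : ℝ × ℝ) : ∫ s, kF s p r = ((Real.pi * hF p r : ℝ) : ℂ) := by
  have hc : (starRingEnd ℂ) (∫ s, kF s p r) = ∫ s, kF s p r := by
    rw [← integral_conj]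
    simp_rw [← kF_neg]
    exact integral_neg_eq_self (fun s => kF s p r) volume
  rw [← Complex.conj_eq_iff_re.1 hc]
  congr 1
  have := integral_re (𝕜 := ℂ) (kF_integrable p r)
  simp only [RCLike.re_to_complex] at this
  rw [← this]
  simp_rw [kF_re]
  have i := psi_integrable
  have e1 := integral_sub (((i (p.1 - r.2)).add (i (p.2 - r.1))).sub (i (p.1 - r.1))) (i (p.2 - r.2))
  have e2 := integral_sub ((i (p.1 - r.2)).add (i (p.2 - r.1))) (i (p.1 - r.1))
  have e3 := integral_add (i (p.1 - r.2)) (i (p.2 - r.1))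
  simp only [Pi.add_apply, Pi.sub_apply] at e1 e2 e3
  rw [e1, e2, e3]
  simp only [psi_integral, hF]; ring

/-- the dominating function -/
lemma dom_integrable (P : Measure ((ℝ × ℝ) × (ℝ × ℝ))) [SFinite P]
    (hP : Integrable (fun q : (ℝ × ℝ) × (ℝ × ℝ) => |q.1.1 - q.1.2| * |q.2.1 - q.2.2|) P) :
    Integrable (fun z : ((ℝ × ℝ) × (ℝ × ℝ)) × (ℝ × ℝ) =>
      psi (z.1.1.1 - z.1.1.2) z.2.1 * psi (z.1.2.1 - z.1.2.2) z.2.2) (P.prod volume) := by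
  rw [integrable_prod_iff]
  · constructor
    · filter_upwards with q
      exact (psi_integrable _).mul_prod (psi_integrable _)
    · have : ∀ q : (ℝ × ℝ) × (ℝ × ℝ), ∫ y : ℝ × ℝ, ‖psi (q.1.1 - q.1.2) y.1 * psi (q.2.1 - q.2.2) y.2‖
        = Real.pi ^ 2 * (|q.1.1 - q.1.2| * |q.2.1 - q.2.2|) := by
        intro q
        have : ∀ y : ℝ × ℝ, ‖psi (q.1.1 - q.1.2) y.1 * psi (q.2.1 - q.2.2) y.2‖
          = psi (q.1.1 - q.1.2) y.1 * psi (q.2.1 - q.2.2) y.2 := fun y =>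
          Real.norm_of_nonneg (mul_nonneg (psi_nonneg _ _) (psi_nonneg _ _))
        simp_rw [this]
        rw [Measure.volume_eq_prod, integral_prod_mul (psi _) (psi _), psi_integral, psi_integral]; ring
      simp only [this]
      exact hP.const_mul _
  · apply Measurable.aestronglyMeasurable
    unfold psi; fun_prop

lemma kk_integrable (P : Measure ((ℝ × ℝ) × (ℝ × ℝ))) [SFinite P]
    (hP : Integrable (fun q : (ℝ × ℝ) × (ℝ × ℝ) => |q.1.1 - q.1.2| * |q.2.1 - q.2.2|) P) :
    Integrable (fun z : ((ℝ × ℝ) × (ℝ × ℝ)) × (ℝ × ℝ) =>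
      kF z.2.1 z.1.1 z.1.2 * kF z.2.2 z.1.1 z.1.2) (P.prod volume) := by
  have hS : MeasurePreserving (Prod.map id Prod.swap : ((ℝ × ℝ) × (ℝ × ℝ)) × (ℝ × ℝ) → _)
      (P.prod volume) (P.prod volume) :=
    (MeasurePreserving.id P).prod Measure.measurePreserving_swap
  have hP' : Integrable (fun z : ((ℝ × ℝ) × (ℝ × ℝ)) × (ℝ × ℝ) =>
      psi (z.1.1.1 - z.1.1.2) z.2.2 * psi (z.1.2.1 - z.1.2.2) z.2.1) (P.prod volume) :=
    hS.integrable_comp_of_integrable (dom_integrable P hP)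
  refine (((dom_integrable P hP).add hP').const_mul 2).mono' ?_ ?_
  · apply Measurable.aestronglyMeasurable
    exact (kF_meas.comp (f := fun z : ((ℝ × ℝ) × (ℝ × ℝ)) × (ℝ × ℝ) => (z.2.1, z.1)) (by fun_prop)).mul
      (kF_meas.comp (f := fun z : ((ℝ × ℝ) × (ℝ × ℝ)) × (ℝ × ℝ) => (z.2.2, z.1)) (by fun_prop))
  · filter_upwards with z
    obtain ⟨⟨p, r⟩, s, t⟩ := z
    simp only [Pi.add_apply, norm_mul, kF_norm]
    have h1 := aF_psi s p
    have h2 := aF_psi s r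
    have h3 := aF_psi t p
    have h4 := aF_psi t r
    have e : 2 * (psi (p.1 - p.2) s * psi (r.1 - r.2) t + psi (p.1 - p.2) t * psi (r.1 - r.2) s)
      = ((‖aF s p‖ * ‖aF t r‖) ^ 2 + (‖aF t p‖ * ‖aF s r‖) ^ 2) / 2 / (s ^ 2 * t ^ 2) := by
      have k1 : psi (p.1 - p.2) s = ‖aF s p‖ ^ 2 / s ^ 2 / 2 := by linarith
      have k2 : psi (r.1 - r.2) s = ‖aF s r‖ ^ 2 / s ^ 2 / 2 := by linarith
      have k3 : psi (p.1 - p.2) t = ‖aF t p‖ ^ 2 / t ^ 2 / 2 := by linarith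
      have k4 : psi (r.1 - r.2) t = ‖aF t r‖ ^ 2 / t ^ 2 / 2 := by linarith
      rw [k1, k2, k3, k4]
      ring
    rw [e, div_mul_div_comm]
    gcongr
    nlinarith [sq_nonneg (‖aF s p‖ * ‖aF t r‖ - ‖aF t p‖ * ‖aF s r‖)]

lemma hF_bound (p r : ℝ × ℝ) : hF p r ^ 2 ≤ 4 * (|p.1 - p.2| * |r.1 - r.2|) := by
  have h1 : |hF p r| ≤ 2 * |p.1 - p.2| := by
    have a := abs_sub_le p.1 p.2 r.2
    have b := abs_sub_le p.1 p.2 r.1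
    have c := abs_sub_le p.2 p.1 r.2
    have d := abs_sub_le p.2 p.1 r.1
    rw [abs_sub_comm p.2 p.1] at c d
    rw [abs_le]; unfold hF; constructor <;> linarith
  have h2 : |hF p r| ≤ 2 * |r.1 - r.2| := by
    have a := abs_sub_le p.1 r.1 r.2
    have b := abs_sub_le p.1 r.2 r.1
    have c := abs_sub_le p.2 r.1 r.2
    have d := abs_sub_le p.2 r.2 r.1
    rw [abs_sub_comm r.2 r.1] at b d
    rw [abs_le]; unfold hF; constructor <;> linarith
  rw [← sq_abs]
  nlinarith [abs_nonneg (hF p r), abs_nonneg (r.1 - r.2), mul_le_mul h1 h2 (abs_nonneg _) (by positivity)]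

lemma comb (a b c d : ℝ) : hF (a, b) (c, d) ^ 2 + hF (a, c) (b, d) ^ 2 + hF (a, d) (b, c) ^ 2
    = 8 * (ostat3of4 a b c d - ostat2of4 a b c d) ^ 2 := by
  unfold hF ostat3of4 ostat2of4
  rcases lt_or_ge a b with h1 | h1 <;> rcases lt_or_ge b c with h2 | h2 <;>
  rcases lt_or_ge a c with h3 | h3 <;> rcases lt_or_ge c d with h4 | h4 <;>
  rcases lt_or_ge b d with h5 | h5 <;> rcases lt_or_ge a d with h6 | h6 <;>
  first
  | (exfalso; linarith)
  | (try have h1 := le_of_lt h1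
     try have h2 := le_of_lt h2
     try have h3 := le_of_lt h3
     try have h4 := le_of_lt h4
     try have h5 := le_of_lt h5
     try have h6 := le_of_lt h6
     simp only [abs_of_nonneg, abs_of_nonpos, sub_nonneg, sub_nonpos, max_eq_left, max_eq_right,
       min_eq_left, min_eq_right, max_self, min_self, h1, h2, h3, h4, h5, h6]
     ring)

lemma charF_eq (μ : Measure ℝ) (t : ℝ) : charF μ t = ∫ x, eF t x ∂μ := rfl

lemma eF_int (μ : Measure ℝ) [IsProbabilityMeasure μ] (s : ℝ) : Integrable (eF s) μ := by
  refine (integrable_const (1:ℝ)).mono' ?_ ?_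
  · exact (eF_meas.comp (f := fun x : ℝ => (s, x)) (by fun_prop)).aestronglyMeasurable
  · filter_upwards with x using (eF_norm s x).le

lemma eF_add (s t x : ℝ) : eF (s + t) x = eF s x * eF t x := by
  unfold eF
  rw [← Complex.exp_add]; congr 1; push_cast; ring

lemma aa_integral (μ : Measure ℝ) [IsProbabilityMeasure μ] (s t : ℝ) :
    ∫ p, aF s p * aF t p ∂(μ.prod μ) = 2 * (charF μ (s + t) - charF μ s * charF μ t) := by
  have e : ∀ p, aF s p * aF t p = (eF (s + t) p.1 * (1 : ℂ) + 1 * eF (s + t) p.2)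
      - (eF s p.1 * eF t p.2 + eF t p.1 * eF s p.2) := by
    intro p; simp only [aF, eF_add]; ring
  simp_rw [e]
  have i1 : Integrable (fun p : ℝ × ℝ => eF (s + t) p.1 * (1 : ℂ)) (μ.prod μ) :=
    (eF_int μ _).mul_prod (integrable_const _)
  have i2 : Integrable (fun p : ℝ × ℝ => (1 : ℂ) * eF (s + t) p.2) (μ.prod μ) :=
    Integrable.mul_prod (f := fun _ : ℝ => (1 : ℂ)) (integrable_const _) (eF_int μ _)
  have i3 : Integrable (fun p : ℝ × ℝ => eF s p.1 * eF t p.2) (μ.prod μ) :=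
    (eF_int μ _).mul_prod (eF_int μ _)
  have i4 : Integrable (fun p : ℝ × ℝ => eF t p.1 * eF s p.2) (μ.prod μ) :=
    (eF_int μ _).mul_prod (eF_int μ _)
  have e0 := integral_sub (i1.add i2) (i3.add i4)
  simp only [Pi.add_apply] at e0
  rw [e0, integral_add i1 i2, integral_add i3 i4,
    integral_prod_mul (eF (s + t)) (fun _ => (1 : ℂ)),
    integral_prod_mul (fun _ => (1 : ℂ)) (eF (s + t)),
    integral_prod_mul (eF s) (eF t), integral_prod_mul (eF t) (eF s)]
  simp only [charF_eq, integral_const, probReal_univ, one_smul]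
  ring

lemma kk_integral (μ : Measure ℝ) [IsProbabilityMeasure μ] (s t : ℝ) :
    ∫ q, kF s q.1 q.2 * kF t q.1 q.2 ∂((μ.prod μ).prod (μ.prod μ)) =
      ((4 * (‖charF μ (s + t) - charF μ s * charF μ t‖ ^ 2 / (s ^ 2 * t ^ 2)) : ℝ) : ℂ) := by
  have e : ∀ q : (ℝ × ℝ) × (ℝ × ℝ), kF s q.1 q.2 * kF t q.1 q.2 =
      (((s ^ 2 * t ^ 2 : ℝ) : ℂ))⁻¹ *
        ((aF s q.1 * aF t q.1) * (starRingEnd ℂ) (aF s q.2 * aF t q.2)) := by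
    intro q; simp only [kF, map_mul]; push_cast; ring
  simp_rw [e]
  rw [integral_const_mul, integral_prod_mul (fun p => aF s p * aF t p)
    (fun p => (starRingEnd ℂ) (aF s p * aF t p)), integral_conj, aa_integral, Complex.mul_conj,
    Complex.normSq_eq_norm_sq, norm_mul]
  push_cast
  simp
  ring

lemma base_integrable (μ : Measure ℝ) [IsProbabilityMeasure μ]
    (h1 : Integrable (fun x => |x|) μ) :
    Integrable (fun q : (ℝ × ℝ) × (ℝ × ℝ) => |q.1.1 - q.1.2| * |q.2.1 - q.2.2|)
      ((μ.prod μ).prod (μ.prod μ)) := by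
  have h : Integrable (fun x : ℝ => x) μ :=
    (integrable_norm_iff measurable_id.aestronglyMeasurable).1 h1
  have h2 : Integrable (fun p : ℝ × ℝ => |p.1 - p.2|) (μ.prod μ) :=
    ((h.comp_fst μ).sub (h.comp_snd μ)).abs
  exact h2.mul_prod h2

lemma distVar_eq (μ : Measure ℝ) [IsProbabilityMeasure μ]
    (h1 : Integrable (fun x => |x|) μ) :
    distVar μ = (1 / 4) * ∫ q, hF q.1 q.2 ^ 2 ∂((μ.prod μ).prod (μ.prod μ)) := by
  have hk := kk_integrable ((μ.prod μ).prod (μ.prod μ)) (base_integrable μ h1)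
  have sw := integral_integral_swap (f := fun (q : (ℝ × ℝ) × (ℝ × ℝ)) (y : ℝ × ℝ) =>
    kF y.1 q.1 q.2 * kF y.2 q.1 q.2) hk
  simp_rw [kk_integral] at sw
  have e : ∀ q : (ℝ × ℝ) × (ℝ × ℝ), ∫ y : ℝ × ℝ, kF y.1 q.1 q.2 * kF y.2 q.1 q.2
      = ((Real.pi ^ 2 * hF q.1 q.2 ^ 2 : ℝ) : ℂ) := by
    intro q
    rw [Measure.volume_eq_prod, integral_prod_mul (fun s => kF s q.1 q.2) (fun s => kF s q.1 q.2),
      kF_integral]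
    push_cast; ring
  simp_rw [e] at sw
  rw [integral_complex_ofReal, integral_complex_ofReal, Complex.ofReal_inj,
    integral_const_mul, integral_const_mul] at sw
  unfold distVar
  have : Real.pi ≠ 0 := Real.pi_ne_zero
  field_simp
  linarith

lemma hF_meas : Measurable (fun q : (ℝ × ℝ) × (ℝ × ℝ) => hF q.1 q.2 ^ 2) := by
  unfold hF
  simp only [← Real.norm_eq_abs]
  fun_prop

lemma hF_integrable (μ : Measure ℝ) [IsProbabilityMeasure μ]
    (h1 : Integrable (fun x => |x|) μ) :
    Integrable (fun q : (ℝ × ℝ) × (ℝ × ℝ) => hF q.1 q.2 ^ 2) ((μ.prod μ).prod (μ.prod μ)) := by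
  refine ((base_integrable μ h1).const_mul 4).mono' hF_meas.aestronglyMeasurable ?_
  filter_upwards with q
  rw [Real.norm_of_nonneg (sq_nonneg _)]
  exact hF_bound _ _

lemma assoc_mp {α β γ : Type*} [MeasurableSpace α] [MeasurableSpace β] [MeasurableSpace γ]
    (μ : Measure α) (ν : Measure β) (τ : Measure γ) [SFinite μ] [SFinite ν] [SFinite τ] :
    MeasurePreserving (MeasurableEquiv.prodAssoc (α := α) (β := β) (γ := γ))
      ((μ.prod ν).prod τ) (μ.prod (ν.prod τ)) :=
  ⟨MeasurableEquiv.prodAssoc.measurable, Measure.prodAssoc_prod⟩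

lemma left_mp (μ : Measure ℝ) [IsProbabilityMeasure μ] :
    MeasurePreserving (fun x : ℝ × ℝ × ℝ => (x.2.1, x.1, x.2.2))
      (μ.prod (μ.prod μ)) (μ.prod (μ.prod μ)) :=
  (assoc_mp μ μ μ).comp (((Measure.measurePreserving_swap (μ := μ) (ν := μ)).prod
    (MeasurePreserving.id μ)).comp (assoc_mp μ μ μ).symm)

lemma rot_mp (μ : Measure ℝ) [IsProbabilityMeasure μ] :
    MeasurePreserving (fun x : ℝ × ℝ × ℝ => (x.2.2, x.1, x.2.1))
      (μ.prod (μ.prod μ)) (μ.prod (μ.prod μ)) :=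
  (left_mp μ).comp ((MeasurePreserving.id μ).prod
    (Measure.measurePreserving_swap (μ := μ) (ν := μ)))

/-- For `X` real with `E|X| < ∞` and i.i.d. copies `X, X', X'', X'''` with order statistics
`X₁:₄ ≤ X₂:₄ ≤ X₃:₄ ≤ X₄:₄`, the distance variance satisfies
`V²(X) = (2/3) E[(X₃:₄ - X₂:₄)²]`. -/
theorem distVar_central_spacing (μ : Measure ℝ) [IsProbabilityMeasure μ]
    (h1 : Integrable (fun x => |x|) μ) :
    distVar μ =
      (2 / 3) * ∫ q : ℝ × ℝ × ℝ × ℝ,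
        (ostat3of4 q.1 q.2.1 q.2.2.1 q.2.2.2 - ostat2of4 q.1 q.2.1 q.2.2.1 q.2.2.2) ^ 2
          ∂(μ.prod (μ.prod (μ.prod μ))) := by
  have hm : MeasurePreserving (fun q : ℝ × ℝ × ℝ × ℝ => ((q.1, q.2.1), q.2.2))
      (μ.prod (μ.prod (μ.prod μ))) ((μ.prod μ).prod (μ.prod μ)) :=
    (assoc_mp μ μ (μ.prod μ)).symm
  have hm2 : MeasurePreserving (fun q : ℝ × ℝ × ℝ × ℝ => ((q.1, q.2.2.1), (q.2.1, q.2.2.2)))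
      (μ.prod (μ.prod (μ.prod μ))) ((μ.prod μ).prod (μ.prod μ)) :=
    hm.comp ((MeasurePreserving.id μ).prod (left_mp μ))
  have hm3 : MeasurePreserving (fun q : ℝ × ℝ × ℝ × ℝ => ((q.1, q.2.2.2), (q.2.1, q.2.2.1)))
      (μ.prod (μ.prod (μ.prod μ))) ((μ.prod μ).prod (μ.prod μ)) :=
    hm.comp ((MeasurePreserving.id μ).prod (rot_mp μ))
  have key : ∀ T : ℝ × ℝ × ℝ × ℝ → (ℝ × ℝ) × (ℝ × ℝ),
      MeasurePreserving T (μ.prod (μ.prod (μ.prod μ))) ((μ.prod μ).prod (μ.prod μ)) →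
      Integrable (fun q => hF (T q).1 (T q).2 ^ 2) (μ.prod (μ.prod (μ.prod μ))) ∧
      ∫ q, hF (T q).1 (T q).2 ^ 2 ∂(μ.prod (μ.prod (μ.prod μ))) =
        ∫ q, hF q.1 q.2 ^ 2 ∂((μ.prod μ).prod (μ.prod μ)) := by
    intro T hT
    refine ⟨hT.integrable_comp_of_integrable (hF_integrable μ h1), ?_⟩
    rw [← hT.map_eq, integral_map hT.measurable.aemeasurable hF_meas.aestronglyMeasurable]
  obtain ⟨i1, e1⟩ := key _ hm
  obtain ⟨i2, e2⟩ := key _ hm2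
  obtain ⟨i3, e3⟩ := key _ hm3
  have e : ∀ q : ℝ × ℝ × ℝ × ℝ,
      (ostat3of4 q.1 q.2.1 q.2.2.1 q.2.2.2 - ostat2of4 q.1 q.2.1 q.2.2.1 q.2.2.2) ^ 2 =
      (1 / 8) * (hF (q.1, q.2.1) q.2.2 ^ 2 + hF (q.1, q.2.2.1) (q.2.1, q.2.2.2) ^ 2
        + hF (q.1, q.2.2.2) (q.2.1, q.2.2.1) ^ 2) := by
    intro q
    have := comb q.1 q.2.1 q.2.2.1 q.2.2.2
    simp only [Prod.mk.eta] at this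
    linarith
  simp_rw [e]
  have e4 := integral_add (i1.add i2) i3
  have e5 := integral_add i1 i2
  simp only [Pi.add_apply] at e4 e5
  rw [integral_const_mul, e4, e5, e1, e2, e3, distVar_eq μ h1]
  ring
end

section
/- Let X be Pareto distributed with parameters \alpha > 1 and x_m > 0, i.e., with cdf F(x) = 1 - (x_m/x)^\alpha for x \ge x_m. Then the distance variance V^2(X) = 4 \alpha^2 x_m^2 / ((\alpha-1)(2\alpha-1)^2(3\alpha-2)). -/
open MeasureTheory

open FourierTransform SchwartzMap ContDiff in
theorem plancherel_aux (f : ℝ → ℂ) (h1 : Integrable f) (h2 : MemLp f 2) :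
    ∫⁻ s, ‖𝓕 f s‖ₑ ^ 2 = ∫⁻ x, ‖f x‖ₑ ^ 2 := by
  have hc : Continuous (𝓕 f) :=
    VectorFourier.fourierIntegral_continuous Real.continuous_fourierChar
      (by exact continuous_inner) h1
  have key : 𝓕 f =ᵐ[volume] (𝓕 (h2.toLp f) : Lp ℂ 2 (volume : Measure ℝ)) := by
    apply ae_eq_of_integral_contDiff_smul_eq
    · exact hc.locallyIntegrable
    · exact (Lp.memLp _).locallyIntegrable (by norm_num)
    intro g g_smooth g_cpt
    have hg₁ : HasCompactSupport (Complex.ofRealCLM ∘ g) := g_cpt.comp_left rfl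
    have hg₂ : ContDiff ℝ ∞ (Complex.ofRealCLM ∘ g) := by fun_prop
    set G : 𝓢(ℝ, ℂ) := hg₁.toSchwartzMap hg₂ with hG
    have e1 := congrArg (fun T => T G) (Lp.fourier_toTemperedDistribution_eq (h2.toLp f))
    simp only [TemperedDistribution.fourier_apply, Lp.toTemperedDistribution_apply] at e1
    have e2 : ∫ x, (𝓕 G) x • (h2.toLp f) x = ∫ x, (𝓕 G) x • f x := by
      apply integral_congr_ae
      filter_upwards [h2.coeFn_toLp] with x hx
      rw [hx]
    have e3 : ∫ x, (𝓕 (G : ℝ → ℂ)) x • f x = ∫ x, G x • 𝓕 f x := by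
      have := VectorFourier.integral_fourierIntegral_smul_eq_flip (L := innerₗ ℝ)
        (μ := volume) (ν := volume) Real.continuous_fourierChar
        (by exact continuous_inner) G.integrable h1
      rw [flip_innerₗ] at this
      exact this
    have e4 : ∀ F : ℝ → ℂ, ∫ x, g x • F x = ∫ x, G x • F x := by
      intro F
      simp [hG]
    rw [e4, e4, ← e1, e2, ← e3, SchwartzMap.fourier_coe]
  have hn := Lp.norm_fourier_eq (h2.toLp f)
  have hn' : eLpNorm (𝓕 f) 2 volume = eLpNorm f 2 volume := by
    rw [eLpNorm_congr_ae key, ← eLpNorm_congr_ae h2.coeFn_toLp, ← Lp.enorm_def, ← Lp.enorm_def,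
      ← ofReal_norm, ← ofReal_norm, hn]
  rw [eLpNorm_eq_lintegral_rpow_enorm_toReal (by norm_num) (by norm_num),
    eLpNorm_eq_lintegral_rpow_enorm_toReal (by norm_num) (by norm_num)] at hn'
  have := congrArg (fun t => t ^ (2:ℝ)) hn'
  simp only [← ENNReal.rpow_mul] at this
  norm_num at this
  exact this

open FourierTransform in
theorem plancherel_exp (f : ℝ → ℂ) (h1 : Integrable f) (h2 : MemLp f 2) :
    ∫⁻ s : ℝ, ‖∫ x : ℝ, Complex.exp ((s * x : ℝ) * Complex.I) * f x‖ₑ ^ 2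
      = ENNReal.ofReal (2 * Real.pi) * ∫⁻ x, ‖f x‖ₑ ^ 2 := by
  have hc : Continuous (𝓕 f) :=
    VectorFourier.fourierIntegral_continuous Real.continuous_fourierChar
      (by exact continuous_inner) h1
  have e : ∀ s : ℝ, (∫ x : ℝ, Complex.exp ((s * x : ℝ) * Complex.I) * f x)
      = 𝓕 f ((-(2*Real.pi)⁻¹) * s) := by
    intro s
    rw [Real.fourier_real_eq_integral_exp_smul]
    congr 1; ext x
    rw [smul_eq_mul]
    congr 2
    push_cast
    have : (Real.pi : ℂ) ≠ 0 := by exact_mod_cast Real.pi_ne_zero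
    field_simp
  simp_rw [e]
  rw [← plancherel_aux f h1 h2]
  have hm := Real.map_volume_mul_left (a := -(2*Real.pi)⁻¹) (by simp [Real.pi_ne_zero])
  rw [← lintegral_map (f := fun y => ‖𝓕 f y‖ₑ ^ 2) (g := fun s => -(2*Real.pi)⁻¹ * s) (by fun_prop) (by fun_prop), hm, lintegral_smul_measure]
  congr 2
  rw [inv_neg, inv_inv, abs_neg, abs_of_pos (by positivity)]

theorem exp_integral_aux (s x : ℝ) (hs : s ≠ 0) (hx : 0 ≤ x) :
    (s * Complex.I) * ∫ u in Set.Ioo 0 x, Complex.exp ((s * u : ℝ) * Complex.I)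
      = Complex.exp ((s * x : ℝ) * Complex.I) - 1 := by
  rw [← integral_Ioc_eq_integral_Ioo, ← intervalIntegral.integral_of_le hx]
  have hc : (s * Complex.I : ℂ) ≠ 0 := by simp [hs]
  have := integral_exp_mul_complex (a := 0) (b := x) hc
  have e : ∀ u : ℝ, Complex.exp ((s * u : ℝ) * Complex.I) = Complex.exp (s * Complex.I * u) := by
    intro u; congr 1; push_cast; ring
  simp_rw [e]
  rw [this, mul_div_cancel₀ _ hc]
  simp

theorem prod_integrable (μ : Measure ℝ) [IsProbabilityMeasure μ]
    (hint : Integrable (fun x => x) μ) (k : ℝ → ℂ) (hk : Measurable k)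
    (M : ℝ) (hM : ∀ x, ‖k x‖ ≤ M) (s : ℝ) :
    Integrable (fun p : ℝ × ℝ => (Set.Ioo 0 p.1).indicator
      (fun u => Complex.exp ((s * u : ℝ) * Complex.I) * k p.1) p.2) (μ.prod volume) := by
  have hmeas : Measurable (fun p : ℝ × ℝ => (Set.Ioo 0 p.1).indicator
      (fun u => Complex.exp ((s * u : ℝ) * Complex.I) * k p.1) p.2) := by
    have : (fun p : ℝ × ℝ => (Set.Ioo 0 p.1).indicator
      (fun u => Complex.exp ((s * u : ℝ) * Complex.I) * k p.1) p.2)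
      = ({p : ℝ × ℝ | 0 < p.2} ∩ {p | p.2 < p.1}).indicator
        (fun p => Complex.exp ((s * p.2 : ℝ) * Complex.I) * k p.1) := by
      ext p
      simp [Set.indicator, Set.mem_Ioo]
    rw [this]
    refine Measurable.indicator (by fun_prop) ?_
    exact (measurableSet_lt measurable_const measurable_snd).inter
      (measurableSet_lt measurable_snd measurable_fst)
  rw [integrable_prod_iff hmeas.aestronglyMeasurable]
  have hn : ∀ x u : ℝ, ‖Complex.exp ((s * u : ℝ) * Complex.I) * k x‖ = ‖k x‖ := by
    intro x u; rw [norm_mul, Complex.norm_exp_ofReal_mul_I, one_mul]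
  constructor
  · refine Filter.Eventually.of_forall fun x => ?_
    refine (integrable_indicator_iff (f := fun u : ℝ =>
      Complex.exp ((s * u : ℝ) * Complex.I) * k x) measurableSet_Ioo).2 ?_
    refine Continuous.integrableOn_Icc (a := 0) (b := x) (by fun_prop) |>.mono_set Set.Ioo_subset_Icc_self
  · have : ∀ x : ℝ, ∫ u, ‖(Set.Ioo 0 x).indicator
      (fun u => Complex.exp ((s * u : ℝ) * Complex.I) * k x) u‖ = max x 0 * ‖k x‖ := by
      intro x
      simp_rw [norm_indicator_eq_indicator_norm, hn]
      rw [integral_indicator measurableSet_Ioo]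
      simp
    simp_rw [this]
    refine Integrable.mul_bdd (c := M) hint.pos_part hk.norm.aestronglyMeasurable ?_
    exact Filter.Eventually.of_forall fun x => by simpa using hM x

/-- Tail function. -/
noncomputable def tailF (μ : Measure ℝ) (k : ℝ → ℂ) : ℝ → ℂ :=
  (Set.Ioi (0:ℝ)).indicator fun u => ∫ x in Set.Ioi u, k x ∂μ

theorem tailF_eq (μ : Measure ℝ) (k : ℝ → ℂ) (s u : ℝ) :
    ∫ x, (Set.Ioo 0 x).indicator
      (fun u => Complex.exp ((s * u : ℝ) * Complex.I) * k x) u ∂μ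
      = Complex.exp ((s * u : ℝ) * Complex.I) * tailF μ k u := by
  by_cases hu : 0 < u
  · have : ∀ x, (Set.Ioo 0 x).indicator
      (fun u => Complex.exp ((s * u : ℝ) * Complex.I) * k x) u =
        Complex.exp ((s * u : ℝ) * Complex.I) * (Set.Ioi u).indicator k x := by
      intro x; simp [Set.indicator, hu]
    simp_rw [this]
    rw [integral_const_mul, integral_indicator measurableSet_Ioi, tailF,
      Set.indicator_of_mem (by exact hu)]
  · simp [tailF, Set.indicator, hu]

theorem tailF_integrable (μ : Measure ℝ) [IsProbabilityMeasure μ]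
    (hint : Integrable (fun x => x) μ) (k : ℝ → ℂ) (hk : Measurable k)
    (M : ℝ) (hM : ∀ x, ‖k x‖ ≤ M) : Integrable (tailF μ k) := by
  have := (prod_integrable μ hint k hk M hM 0).integral_prod_right
  simp only [tailF_eq] at this
  simpa using this

theorem tailF_memLp (μ : Measure ℝ) [IsProbabilityMeasure μ]
    (hint : Integrable (fun x => x) μ) (k : ℝ → ℂ) (hk : Measurable k)
    (M : ℝ) (hM : ∀ x, ‖k x‖ ≤ M) : MemLp (tailF μ k) 2 := by
  have h := tailF_integrable μ hint k hk M hM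
  rw [memLp_two_iff_integrable_sq_norm h.1]
  simp_rw [pow_two]
  refine Integrable.mul_bdd (c := M) h.norm h.norm.1 ?_
  refine Filter.Eventually.of_forall fun u => ?_
  have hM0 : 0 ≤ M := (norm_nonneg _).trans (hM 0)
  rw [norm_norm, tailF]
  refine (norm_indicator_le_norm_self _ _).trans ?_
  refine (norm_setIntegral_le_of_norm_le_const (C := M) (measure_lt_top _ _) (fun x _ => hM x)).trans ?_
  exact mul_le_of_le_one_right hM0 measureReal_le_one

theorem exp_eq_tail (μ : Measure ℝ) [IsProbabilityMeasure μ]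
    (hpos : ∀ᵐ x ∂μ, 0 ≤ x)
    (hint : Integrable (fun x => x) μ) (k : ℝ → ℂ) (hk : Measurable k)
    (M : ℝ) (hM : ∀ x, ‖k x‖ ≤ M) (h0 : ∫ x, k x ∂μ = 0) (s : ℝ) (hs : s ≠ 0) :
    ∫ x, Complex.exp ((s * x : ℝ) * Complex.I) * k x ∂μ =
      (s * Complex.I) * ∫ u, Complex.exp ((s * u : ℝ) * Complex.I) * tailF μ k u := by
  have hsw := integral_integral_swap (f := fun x u => (Set.Ioo 0 x).indicator
      (fun u => Complex.exp ((s * u : ℝ) * Complex.I) * k x) u) (prod_integrable μ hint k hk M hM s)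
  simp only [tailF_eq] at hsw
  rw [← hsw, ← integral_const_mul]
  have hki : Integrable k μ := Integrable.of_bound hk.aestronglyMeasurable M
    (Filter.Eventually.of_forall hM)
  have hei : Integrable (fun x => Complex.exp ((s * x : ℝ) * Complex.I) * k x) μ := by
    refine Integrable.of_bound (by fun_prop) M (Filter.Eventually.of_forall fun x => ?_)
    rw [norm_mul, Complex.norm_exp_ofReal_mul_I, one_mul]; exact hM x
  rw [← sub_zero (∫ x, Complex.exp ((s * x : ℝ) * Complex.I) * k x ∂μ), ← h0,
    ← integral_sub hei hki]
  apply integral_congr_ae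
  filter_upwards [hpos] with x hx
  rw [integral_indicator measurableSet_Ioo, integral_mul_const, ← mul_assoc,
    exp_integral_aux s x hs hx]
  ring

theorem cov_plancherel (μ : Measure ℝ) [IsProbabilityMeasure μ]
    (hpos : ∀ᵐ x ∂μ, 0 ≤ x)
    (hint : Integrable (fun x => x) μ) (k : ℝ → ℂ) (hk : Measurable k)
    (M : ℝ) (hM : ∀ x, ‖k x‖ ≤ M) (h0 : ∫ x, k x ∂μ = 0) :
    ∫⁻ s : ℝ, ENNReal.ofReal
        (‖∫ x, Complex.exp ((s * x : ℝ) * Complex.I) * k x ∂μ‖ ^ 2 / s ^ 2)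
      = ENNReal.ofReal (2 * Real.pi) *
        ∫⁻ u in Set.Ioi (0:ℝ), ENNReal.ofReal (‖∫ x in Set.Ioi u, k x ∂μ‖ ^ 2) := by
  have e1 : ∫⁻ s : ℝ, ENNReal.ofReal
        (‖∫ x, Complex.exp ((s * x : ℝ) * Complex.I) * k x ∂μ‖ ^ 2 / s ^ 2)
      = ∫⁻ s : ℝ, ‖∫ u, Complex.exp ((s * u : ℝ) * Complex.I) * tailF μ k u‖ₑ ^ 2 := by
    apply lintegral_congr_ae
    have : ∀ᵐ s : ℝ, s ≠ 0 := by
      simp [ae_iff]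
    filter_upwards [this] with s hs
    rw [exp_eq_tail μ hpos hint k hk M hM h0 s hs, norm_mul, mul_pow, norm_mul, Complex.norm_I,
      mul_one, Complex.norm_real, Real.norm_eq_abs, sq_abs, mul_div_cancel_left₀ _ (pow_ne_zero 2 hs),
      ENNReal.ofReal_pow (norm_nonneg _), ofReal_norm]
  rw [e1, plancherel_exp _ (tailF_integrable μ hint k hk M hM) (tailF_memLp μ hint k hk M hM),
    ← lintegral_indicator measurableSet_Ioi]
  congr 2
  ext u
  by_cases hu : 0 < u
  · simp [tailF, Set.indicator, hu, ENNReal.ofReal_pow, ofReal_norm]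
  · simp [tailF, Set.indicator, hu]


/-- Pareto survival function. -/
noncomputable def pS (c α u : ℝ) : ℝ := if u ≤ c then 1 else c ^ α * u ^ (-α)

theorem int_one_sub_sq (c α u : ℝ) (hc : 0 < c) (hα : 1 < α) (hu : c < u) :
    ∫ v in Set.Ioc c u, (1 - c ^ α * v ^ (-α)) ^ 2 =
      u + 2 * c ^ α / (α - 1) * u ^ (1 - α) - (c ^ α) ^ 2 / (2 * α - 1) * u ^ (1 - 2 * α)
      - c * (1 + 2 / (α - 1) - 1 / (2 * α - 1)) := by
  rw [← intervalIntegral.integral_of_le hu.le]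
  have a1 : α - 1 ≠ 0 := by linarith
  have a2 : 2 * α - 1 ≠ 0 := by linarith
  have hv : ∀ v ∈ Set.uIcc c u, 0 < v := by
    intro v hv; rw [Set.uIcc_of_le hu.le] at hv; exact hc.trans_le hv.1
  rw [intervalIntegral.integral_eq_sub_of_hasDerivAt
    (f := fun v => v + 2 * c ^ α / (α - 1) * v ^ (1 - α)
      - (c ^ α) ^ 2 / (2 * α - 1) * v ^ (1 - 2 * α))]
  · have k1 : c ^ α * c ^ (1 - α) = c := by rw [← Real.rpow_add hc]; simp
    have k2 : (c ^ α) ^ 2 * c ^ (1 - 2 * α) = c := by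
      rw [← Real.rpow_natCast, ← Real.rpow_mul hc.le, ← Real.rpow_add hc]
      ring_nf; simp
    have : c + 2 * c ^ α / (α - 1) * c ^ (1 - α) - (c ^ α) ^ 2 / (2 * α - 1) * c ^ (1 - 2 * α)
      = c * (1 + 2 / (α - 1) - 1 / (2 * α - 1)) := by
      have : c + 2 * c ^ α / (α - 1) * c ^ (1 - α) - (c ^ α) ^ 2 / (2 * α - 1) * c ^ (1 - 2 * α)
        = c + 2 / (α - 1) * (c ^ α * c ^ (1 - α))
          - 1 / (2 * α - 1) * ((c ^ α) ^ 2 * c ^ (1 - 2 * α)) := by ring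
      rw [this, k1, k2]; ring
    rw [← this]
  · intro v hv'
    have hv0 := hv v hv'
    have d1 := (Real.hasDerivAt_rpow_const (x := v) (p := 1 - α) (Or.inl hv0.ne')).const_mul
      (2 * c ^ α / (α - 1))
    have d2 := (Real.hasDerivAt_rpow_const (x := v) (p := 1 - 2 * α) (Or.inl hv0.ne')).const_mul
      ((c ^ α) ^ 2 / (2 * α - 1))
    refine (((hasDerivAt_id v).add d1).sub d2).congr_deriv ?_
    have e1 : 1 - α - 1 = -α := by ring
    have e2 : v ^ (1 - 2 * α - 1) = (v ^ (-α)) ^ 2 := by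
      rw [← Real.rpow_natCast, ← Real.rpow_mul hv0.le]; congr 1; push_cast; ring
    rw [e1, e2]
    field_simp
    ring
  · apply ContinuousOn.intervalIntegrable
    intro v hv'
    have := hv v hv'
    apply ContinuousAt.continuousWithinAt
    have := Real.continuousAt_rpow_const v (-α) (Or.inl this.ne')
    fun_prop

theorem int_tail_sq (c α u : ℝ) (hc : 0 < c) (hα : 1 < α) (hu : c < u) :
    ∫ v in Set.Ioi u, (c ^ α * v ^ (-α)) ^ 2 = (c ^ α) ^ 2 / (2 * α - 1) * u ^ (1 - 2 * α)
    ∧ IntegrableOn (fun v => (c ^ α * v ^ (-α)) ^ 2) (Set.Ioi u) := by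
  have hu0 := hc.trans hu
  have e : Set.EqOn (fun v => (c ^ α * v ^ (-α)) ^ 2) (fun v => (c ^ α) ^ 2 * v ^ (-2 * α))
    (Set.Ioi u) := by
    intro v hv
    have hv0 : 0 < v := hu0.trans hv
    simp only
    rw [mul_pow, ← Real.rpow_natCast (v ^ (-α)), ← Real.rpow_mul hv0.le]
    congr 2; push_cast; ring
  have a2 : 2 * α - 1 ≠ 0 := by linarith
  constructor
  · rw [setIntegral_congr_fun measurableSet_Ioi e, integral_const_mul,
      integral_Ioi_rpow_of_lt (by linarith) hu0]
    have : -2 * α + 1 = 1 - 2 * α := by ring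
    rw [this]
    have : 1 - 2 * α ≠ 0 := by linarith
    field_simp
    ring
  · rw [integrableOn_congr_fun e measurableSet_Ioi]
    exact (integrableOn_Ioi_rpow_of_lt (by linarith) hu0).const_mul _

/-- inner integral -/
noncomputable def pW (c α u : ℝ) : ℝ :=
  (c ^ α * u ^ (-α)) ^ 2 * (∫ v in Set.Ioc c u, (1 - c ^ α * v ^ (-α)) ^ 2) +
  (1 - c ^ α * u ^ (-α)) ^ 2 * ∫ v in Set.Ioi u, (c ^ α * v ^ (-α)) ^ 2

theorem inner_lint (c α u : ℝ) (hc : 0 < c) (hα : 1 < α) (hu : c < u) :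
    ∫⁻ v in Set.Ioi (0:ℝ), ENNReal.ofReal ((pS c α (max u v) - pS c α u * pS c α v) ^ 2)
      = ENNReal.ofReal (pW c α u) := by
  have hu0 := hc.trans hu
  have s1 : Set.Ioi (0:ℝ) = (Set.Ioc 0 c ∪ Set.Ioc c u) ∪ Set.Ioi u := by
    rw [Set.Ioc_union_Ioc_eq_Ioc hc.le hu.le, Set.Ioc_union_Ioi_eq_Ioi hu0.le]
  rw [s1, lintegral_union measurableSet_Ioi (by
      rw [Set.Ioc_union_Ioc_eq_Ioc hc.le hu.le]; exact Set.Ioc_disjoint_Ioi le_rfl),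
    lintegral_union measurableSet_Ioc (Set.Ioc_disjoint_Ioc_of_le le_rfl)]
  have z : ∫⁻ v in Set.Ioc 0 c,
      ENNReal.ofReal ((pS c α (max u v) - pS c α u * pS c α v) ^ 2) = 0 := by
    rw [setLIntegral_congr_fun (g := fun _ => 0) measurableSet_Ioc, lintegral_zero]
    intro v hv
    have h1 : max u v = u := max_eq_left (hv.2.trans hu.le)
    simp [h1, pS, hv.2]
  rw [z, zero_add, pW, ENNReal.ofReal_add (by positivity) (by positivity)]
  congr 1
  · rw [← integral_const_mul, ofReal_integral_eq_lintegral_ofReal]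
    · apply setLIntegral_congr_fun measurableSet_Ioc
      intro v hv
      simp only
      rw [max_eq_left hv.2]
      simp only [pS, if_neg (not_le.2 hu), if_neg (not_le.2 hv.1)]
      congr 1; ring
    · apply Integrable.const_mul
      apply IntegrableOn.mono_set _ Set.Ioc_subset_Icc_self
      apply ContinuousOn.integrableOn_Icc
      intro v hv'
      have : 0 < v := hc.trans_le hv'.1
      apply ContinuousAt.continuousWithinAt
      have := Real.continuousAt_rpow_const v (-α) (Or.inl this.ne')
      fun_prop
    · exact Filter.Eventually.of_forall fun v => by positivity
  · rw [← integral_const_mul, ofReal_integral_eq_lintegral_ofReal]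
    · apply setLIntegral_congr_fun measurableSet_Ioi
      intro v (hv : u < v)
      simp only
      rw [max_eq_right hv.le]
      simp only [pS, if_neg (not_le.2 hu), if_neg (not_le.2 (hu.trans hv))]
      congr 1; ring
    · apply Integrable.const_mul
      exact (int_tail_sq c α u hc hα hu).2
    · exact Filter.Eventually.of_forall fun v => by positivity

theorem pW_eq (c α u : ℝ) (hc : 0 < c) (hα : 1 < α) (hu : c < u) :
    pW c α u = ((c ^ α) ^ 2 * (2 * α / (2 * α - 1))) * u ^ (1 - 2 * α)
      + (2 * (c ^ α) ^ 3 * α / ((α - 1) * (2 * α - 1))) * u ^ (1 - 3 * α)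
      + (-(c ^ α) ^ 2 * (c * (1 + 2 / (α - 1) - 1 / (2 * α - 1)))) * u ^ (-2 * α) := by
  have hu0 := hc.trans hu
  have a1 : α - 1 ≠ 0 := by linarith
  have a2 : 2 * α - 1 ≠ 0 := by linarith
  rw [pW, int_one_sub_sq c α u hc hα hu, (int_tail_sq c α u hc hα hu).1]
  have p1 : u ^ (1 - α) = u * u ^ (-α) := by
    rw [← Real.rpow_one_add' hu0.le (by linarith)]; congr 1
  have p2 : u ^ (-2 * α) = (u ^ (-α)) ^ 2 := by
    rw [← Real.rpow_natCast, ← Real.rpow_mul hu0.le]; congr 1; push_cast; ring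
  have p3 : u ^ (1 - 2 * α) = u * (u ^ (-α)) ^ 2 := by
    rw [← p2, ← Real.rpow_one_add' hu0.le (by linarith)]; congr 1; ring
  have p4 : u ^ (1 - 3 * α) = u * (u ^ (-α)) ^ 3 := by
    rw [← Real.rpow_natCast, ← Real.rpow_mul hu0.le, ← Real.rpow_one_add' hu0.le (by push_cast; linarith)]
    congr 1; push_cast; ring
  rw [p1, p2, p3, p4]
  generalize u ^ (-α) = w
  generalize c ^ α = K
  obtain ⟨a, ha⟩ : ∃ a, a = α - 1 := ⟨_, rfl⟩
  obtain ⟨b, hb⟩ : ∃ b, b = 2 * α - 1 := ⟨_, rfl⟩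
  rw [← ha] at a1 ⊢
  rw [← hb] at a2 ⊢
  field_simp
  rw [ha, hb]
  ring

theorem pW_nonneg (c α u : ℝ) : 0 ≤ pW c α u := by unfold pW; positivity

theorem outer_lint (c α : ℝ) (hc : 0 < c) (hα : 1 < α) :
    ∫⁻ u in Set.Ioi (0:ℝ), ∫⁻ v in Set.Ioi (0:ℝ),
      ENNReal.ofReal ((pS c α (max u v) - pS c α u * pS c α v) ^ 2)
      = ENNReal.ofReal (α ^ 2 * c ^ 2 / ((α - 1) * (2 * α - 1) ^ 2 * (3 * α - 2))) := by
  rw [← Set.Ioc_union_Ioi_eq_Ioi hc.le, lintegral_union measurableSet_Ioi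
    (Set.Ioc_disjoint_Ioi le_rfl), Set.Ioc_union_Ioi_eq_Ioi hc.le]
  have z : ∫⁻ u in Set.Ioc 0 c, ∫⁻ v in Set.Ioi (0:ℝ),
      ENNReal.ofReal ((pS c α (max u v) - pS c α u * pS c α v) ^ 2) = 0 := by
    rw [setLIntegral_congr_fun (g := fun _ => 0) measurableSet_Ioc, lintegral_zero]
    intro u hu
    simp only
    rw [setLIntegral_congr_fun (g := fun _ => 0) measurableSet_Ioi, lintegral_zero]
    intro v hv
    simp only
    have : pS c α (max u v) - pS c α u * pS c α v = 0 := by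
      by_cases h : v ≤ c
      · simp [pS, h, hu.2]
      · rw [max_eq_right (by linarith [hu.2])]
        simp [pS, hu.2]
    simp [this]
  rw [z, zero_add, setLIntegral_congr_fun (g := fun u => ENNReal.ofReal (pW c α u))
    measurableSet_Ioi (fun u hu => inner_lint c α u hc hα hu)]
  have i1 := integrableOn_Ioi_rpow_of_lt (a := 1 - 2 * α) (by linarith) hc
  have i2 := integrableOn_Ioi_rpow_of_lt (a := 1 - 3 * α) (by linarith) hc
  have i3 := integrableOn_Ioi_rpow_of_lt (a := -2 * α) (by linarith) hc
  have e : Set.EqOn (pW c α) (fun u => ((c ^ α) ^ 2 * (2 * α / (2 * α - 1))) * u ^ (1 - 2 * α)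
      + (2 * (c ^ α) ^ 3 * α / ((α - 1) * (2 * α - 1))) * u ^ (1 - 3 * α)
      + (-(c ^ α) ^ 2 * (c * (1 + 2 / (α - 1) - 1 / (2 * α - 1)))) * u ^ (-2 * α)) (Set.Ioi c) :=
    fun u hu => pW_eq c α u hc hα hu
  rw [← ofReal_integral_eq_lintegral_ofReal]
  · rw [setIntegral_congr_fun measurableSet_Ioi e, integral_add, integral_add,
      integral_const_mul, integral_const_mul, integral_const_mul,
      integral_Ioi_rpow_of_lt (by linarith) hc, integral_Ioi_rpow_of_lt (by linarith) hc,
      integral_Ioi_rpow_of_lt (by linarith) hc]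
    · congr 1
      have hK : c ^ α ≠ 0 := (Real.rpow_pos_of_pos hc α).ne'
      have q1 : c ^ (1 - 2 * α + 1) = c ^ 2 / (c ^ α) ^ 2 := by
        rw [← Real.rpow_natCast (c ^ α), ← Real.rpow_mul hc.le, ← Real.rpow_natCast c,
          ← Real.rpow_sub hc]
        congr 1; push_cast; ring
      have q2 : c ^ (1 - 3 * α + 1) = c ^ 2 / (c ^ α) ^ 3 := by
        rw [← Real.rpow_natCast (c ^ α), ← Real.rpow_mul hc.le, ← Real.rpow_natCast c,
          ← Real.rpow_sub hc]
        congr 1; push_cast; ring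
      have q3 : c ^ (-2 * α + 1) = c / (c ^ α) ^ 2 := by
        rw [← Real.rpow_natCast (c ^ α), ← Real.rpow_mul hc.le]
        nth_rw 2 [← Real.rpow_one c]
        rw [← Real.rpow_sub hc]
        congr 1; push_cast; ring
      rw [q1, q2, q3]
      have r1 : 1 - 2 * α + 1 = -(2 * (α - 1)) := by ring
      have r2 : 1 - 3 * α + 1 = -(3 * α - 2) := by ring
      have r3 : -2 * α + 1 = -(2 * α - 1) := by ring
      rw [r1, r2, r3]
      have a1 : α - 1 ≠ 0 := by linarith
      have a2 : 2 * α - 1 ≠ 0 := by linarith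
      have a3 : 3 * α - 2 ≠ 0 := by linarith
      clear q1 q2 q3 r1 r2 r3 e
      generalize c ^ α = K at *
      obtain ⟨a, ha⟩ : ∃ a, a = α - 1 := ⟨_, rfl⟩
      obtain ⟨b, hb⟩ : ∃ b, b = 2 * α - 1 := ⟨_, rfl⟩
      obtain ⟨d, hd⟩ : ∃ d, d = 3 * α - 2 := ⟨_, rfl⟩
      rw [← ha] at a1 ⊢
      rw [← hb] at a2 ⊢
      rw [← hd] at a3 ⊢
      field_simp
      rw [ha, hb, hd]
      ring
    · exact i1.const_mul _
    · exact i2.const_mul _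
    · exact (i1.const_mul _).add (i2.const_mul _)
    · exact i3.const_mul _
  · change IntegrableOn (pW c α) (Set.Ioi c)
    rw [integrableOn_congr_fun e measurableSet_Ioi]
    exact ((i1.const_mul _).add (i2.const_mul _)).add (i3.const_mul _)
  · exact Filter.Eventually.of_forall fun v => pW_nonneg c α v

theorem exp_integrable (μ : Measure ℝ) [IsProbabilityMeasure μ] (s : ℝ) :
    Integrable (fun x : ℝ => Complex.exp ((s * x : ℝ) * Complex.I)) μ := by
  refine Integrable.of_bound (by fun_prop) 1 (Filter.Eventually.of_forall fun x => ?_)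
  rw [Complex.norm_exp_ofReal_mul_I]

theorem charF_norm_le (μ : Measure ℝ) [IsProbabilityMeasure μ] (s : ℝ) : ‖charF μ s‖ ≤ 1 := by
  refine (norm_integral_le_of_norm_le_const (C := 1) (Filter.Eventually.of_forall fun x => ?_)).trans ?_
  · rw [Complex.norm_exp_ofReal_mul_I]
  · simp

theorem charF_meas (μ : Measure ℝ) [IsProbabilityMeasure μ] : Measurable (charF μ) := by
  have : StronglyMeasurable (fun p : ℝ × ℝ => Complex.exp ((p.1 * p.2 : ℝ) * Complex.I)) :=
    Measurable.stronglyMeasurable (by fun_prop)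
  exact this.integral_prod_right'.measurable

theorem distVar_lint (μ : Measure ℝ) [IsProbabilityMeasure μ]
    (hpos : ∀ᵐ x ∂μ, 0 ≤ x) (hint : Integrable (fun x => x) μ) :
    ∫⁻ q : ℝ × ℝ, ENNReal.ofReal
      (‖charF μ (q.1 + q.2) - charF μ q.1 * charF μ q.2‖ ^ 2 / (q.1 ^ 2 * q.2 ^ 2))
    = ENNReal.ofReal (2 * Real.pi) * (ENNReal.ofReal (2 * Real.pi) *
      ∫⁻ u in Set.Ioi (0:ℝ), ∫⁻ v in Set.Ioi (0:ℝ),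
      ENNReal.ofReal ((μ.real (Set.Ioi (max u v)) - μ.real (Set.Ioi u) * μ.real (Set.Ioi v)) ^ 2)) := by
  have hcm := charF_meas μ
  have hSm : Measurable (fun u : ℝ => μ.real (Set.Ioi u)) := by
    apply Antitone.measurable
    intro a b hab
    exact measureReal_mono (Set.Ioi_subset_Ioi hab)
  -- first application
  have step1 : ∀ s : ℝ, ∫⁻ t : ℝ, ENNReal.ofReal
      (‖charF μ (s + t) - charF μ s * charF μ t‖ ^ 2 / (s ^ 2 * t ^ 2))
      = ENNReal.ofReal (2 * Real.pi) * ∫⁻ u in Set.Ioi (0:ℝ), ENNReal.ofReal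
        (‖∫ x, Complex.exp ((s * x : ℝ) * Complex.I) *
          ((Set.Ioi u).indicator (fun _ => (1:ℂ)) x - (μ.real (Set.Ioi u) : ℂ)) ∂μ‖ ^ 2 / s ^ 2) := by
    intro s
    have h := cov_plancherel μ hpos hint
      (fun x => Complex.exp ((s * x : ℝ) * Complex.I) - charF μ s) (by fun_prop) 2
      (fun x => by
        refine (norm_sub_le _ _).trans ?_
        rw [Complex.norm_exp_ofReal_mul_I]
        linarith [charF_norm_le μ s])
      (by
        rw [integral_sub (exp_integrable μ s) (integrable_const _)]
        simp [charF])
    have e1 : ∀ t : ℝ, ∫ x, Complex.exp ((t * x : ℝ) * Complex.I) *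
        (Complex.exp ((s * x : ℝ) * Complex.I) - charF μ s) ∂μ
        = charF μ (s + t) - charF μ s * charF μ t := by
      intro t
      have : ∀ x : ℝ, Complex.exp ((t * x : ℝ) * Complex.I) *
        (Complex.exp ((s * x : ℝ) * Complex.I) - charF μ s) =
        Complex.exp (((s + t) * x : ℝ) * Complex.I) -
          charF μ s * Complex.exp ((t * x : ℝ) * Complex.I) := by
        intro x
        rw [mul_sub, ← Complex.exp_add]
        congr 1
        · congr 1; push_cast; ring
        · ring
      simp_rw [this]
      rw [integral_sub (exp_integrable μ _) ((exp_integrable μ t).const_mul _),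
        integral_const_mul]
      rfl
    have e2 : ∀ u : ℝ, ∫ x in Set.Ioi u, (Complex.exp ((s * x : ℝ) * Complex.I) - charF μ s) ∂μ
        = ∫ x, Complex.exp ((s * x : ℝ) * Complex.I) *
          ((Set.Ioi u).indicator (fun _ => (1:ℂ)) x - (μ.real (Set.Ioi u) : ℂ)) ∂μ := by
      intro u
      rw [integral_sub (exp_integrable μ s).integrableOn (integrable_const _)]
      simp_rw [mul_sub]
      have : ∀ x, Complex.exp ((s * x : ℝ) * Complex.I) * (Set.Ioi u).indicator (fun _ => (1:ℂ)) x
        = (Set.Ioi u).indicator (fun x : ℝ => Complex.exp ((s * x : ℝ) * Complex.I)) x := by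
        intro x; simp [Set.indicator]
      simp_rw [this]
      rw [integral_sub ((exp_integrable μ s).indicator measurableSet_Ioi)
        ((exp_integrable μ s).mul_const _), integral_indicator measurableSet_Ioi,
        integral_mul_const]
      simp [charF, mul_comm]
    simp only [e1, e2] at h
    have e3 : ∀ t : ℝ, ENNReal.ofReal
      (‖charF μ (s + t) - charF μ s * charF μ t‖ ^ 2 / (s ^ 2 * t ^ 2))
      = ENNReal.ofReal (1 / s ^ 2) * ENNReal.ofReal
      (‖charF μ (s + t) - charF μ s * charF μ t‖ ^ 2 / t ^ 2) := by
      intro t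
      rw [← ENNReal.ofReal_mul (by positivity)]
      congr 1
      rw [div_mul_div_comm, one_mul]
    simp_rw [e3]
    rw [lintegral_const_mul' _ _ ENNReal.ofReal_ne_top, h, mul_left_comm,
      ← lintegral_const_mul' _ _ ENNReal.ofReal_ne_top]
    congr 2
    ext u
    rw [← ENNReal.ofReal_mul (by positivity)]
    congr 1
    ring
  have step2 : ∀ u : ℝ, ∫⁻ s : ℝ, ENNReal.ofReal
        (‖∫ x, Complex.exp ((s * x : ℝ) * Complex.I) *
          ((Set.Ioi u).indicator (fun _ => (1:ℂ)) x - (μ.real (Set.Ioi u) : ℂ)) ∂μ‖ ^ 2 / s ^ 2)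
      = ENNReal.ofReal (2 * Real.pi) * ∫⁻ v in Set.Ioi (0:ℝ),
      ENNReal.ofReal ((μ.real (Set.Ioi (max u v)) - μ.real (Set.Ioi u) * μ.real (Set.Ioi v)) ^ 2) := by
    intro u
    have hi : Integrable ((Set.Ioi u).indicator (fun _ => (1:ℂ))) μ :=
      (integrable_const _).indicator measurableSet_Ioi
    have h := cov_plancherel μ hpos hint
      (fun x => (Set.Ioi u).indicator (fun _ => (1:ℂ)) x - (μ.real (Set.Ioi u) : ℂ))
      ((measurable_const.indicator measurableSet_Ioi).sub_const _) 2
      (fun x => by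
        refine (norm_sub_le _ _).trans ?_
        have h1 : ‖(Set.Ioi u).indicator (fun _ => (1:ℂ)) x‖ ≤ 1 :=
          (norm_indicator_le_norm_self _ _).trans (by simp)
        have h2 : ‖(μ.real (Set.Ioi u) : ℂ)‖ ≤ 1 := by
          rw [Complex.norm_real, Real.norm_eq_abs, abs_of_nonneg measureReal_nonneg]
          exact measureReal_le_one
        linarith)
      (by
        rw [integral_sub hi (integrable_const _), integral_indicator measurableSet_Ioi]
        simp)
    rw [h]
    congr 2
    ext v
    rw [integral_sub hi.integrableOn (integrable_const _), integral_indicator measurableSet_Ioi,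
      Measure.restrict_restrict measurableSet_Ioi, Set.Ioi_inter_Ioi]
    have : (∫ x in Set.Ioi (max u v), (1:ℂ) ∂μ) - ∫ x in Set.Ioi v, (μ.real (Set.Ioi u) : ℂ) ∂μ
      = ((μ.real (Set.Ioi (max u v)) - μ.real (Set.Ioi u) * μ.real (Set.Ioi v) : ℝ) : ℂ) := by
      simp [mul_comm]
    rw [show (u ⊔ v) = max u v from rfl, this, Complex.norm_real, Real.norm_eq_abs, sq_abs]
  rw [Measure.volume_eq_prod, lintegral_prod _ (by
    apply Measurable.aemeasurable
    fun_prop)]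
  simp only
  simp_rw [step1]
  rw [lintegral_const_mul' _ _ ENNReal.ofReal_ne_top, lintegral_lintegral_swap]
  · simp_rw [step2]
    rw [lintegral_const_mul' _ _ ENNReal.ofReal_ne_top]
  · apply Measurable.aemeasurable
    have m1 : StronglyMeasurable (fun p : (ℝ × ℝ) × ℝ =>
        Complex.exp ((p.1.1 * p.2 : ℝ) * Complex.I) *
          ((Set.Ioi p.1.2).indicator (fun _ => (1:ℂ)) p.2 - (μ.real (Set.Ioi p.1.2) : ℂ))) := by
      apply Measurable.stronglyMeasurable
      have : Measurable (fun p : (ℝ × ℝ) × ℝ => (Set.Ioi p.1.2).indicator (fun _ => (1:ℂ)) p.2) := by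
        have : (fun p : (ℝ × ℝ) × ℝ => (Set.Ioi p.1.2).indicator (fun _ => (1:ℂ)) p.2)
          = {p : (ℝ × ℝ) × ℝ | p.1.2 < p.2}.indicator (fun _ => (1:ℂ)) := by
          ext p; simp [Set.indicator]
        rw [this]
        exact measurable_const.indicator (measurableSet_lt (by fun_prop) (by fun_prop))
      have h2 : Measurable (fun p : (ℝ × ℝ) × ℝ => μ.real (Set.Ioi p.1.2)) :=
        hSm.comp (by fun_prop)
      fun_prop
    have m2 := (m1.integral_prod_right' (ν := μ)).measurable
    have m3 : Measurable (fun p : ℝ × ℝ => p.1 ^ 2) := by fun_prop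
    exact ((m2.norm.pow_const 2).div m3).ennreal_ofReal

theorem pareto_pos (c α : ℝ) (hc : 0 < c) :
    ∀ᵐ x ∂(ProbabilityTheory.paretoMeasure c α), 0 ≤ x := by
  rw [ProbabilityTheory.paretoMeasure, ae_withDensity_iff
    (f := ProbabilityTheory.paretoPDF c α) (ProbabilityTheory.measurable_paretoPDFReal c α).ennreal_ofReal]
  refine Filter.Eventually.of_forall fun x hx => ?_
  by_contra h
  exact hx (ProbabilityTheory.paretoPDF_of_lt (by linarith))

theorem pareto_tail (c α u : ℝ) (hc : 0 < c) (hα : 1 < α) :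
    (ProbabilityTheory.paretoMeasure c α).real (Set.Ioi u) = pS c α u := by
  have hα0 : 0 < α := by linarith
  have key : ∀ v, c ≤ v → (ProbabilityTheory.paretoMeasure c α).real (Set.Ioi v)
      = c ^ α * v ^ (-α) := by
    intro v hv
    have hv0 := hc.trans_le hv
    rw [measureReal_def, ProbabilityTheory.paretoMeasure, withDensity_apply _ measurableSet_Ioi,
      setLIntegral_congr_fun measurableSet_Ioi
        (fun x (hx : v < x) => ProbabilityTheory.paretoPDF_of_le (hv.trans hx.le)),
      ← ofReal_integral_eq_lintegral_ofReal, integral_const_mul,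
      integral_Ioi_rpow_of_lt (by linarith) hv0]
    · have : -(α + 1) + 1 = -α := by ring
      rw [this, ENNReal.toReal_ofReal]
      · field_simp
      · have : 0 < v ^ (-α) := Real.rpow_pos_of_pos hv0 _
        have : 0 < c ^ α := Real.rpow_pos_of_pos hc _
        rw [neg_div_neg_eq]
        positivity
    · exact (integrableOn_Ioi_rpow_of_lt (by linarith) hv0).const_mul _
    · rw [Filter.EventuallyLE, ae_restrict_iff' measurableSet_Ioi]
      refine Filter.Eventually.of_forall fun x (hx : v < x) => ?_
      have : 0 < x := hv0.trans hx
      simp only [Pi.zero_apply]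
      positivity
  have := ProbabilityTheory.isProbabilityMeasure_paretoMeasure hc hα0
  unfold pS
  split_ifs with h
  · apply le_antisymm measureReal_le_one
    have h1 : c ^ α * c ^ (-α) = 1 := by rw [← Real.rpow_add hc]; simp
    rw [← h1, ← key c le_rfl]
    exact measureReal_mono (Set.Ioi_subset_Ioi h)
  · exact key u (by linarith)

theorem pareto_int (c α : ℝ) (hc : 0 < c) (hα : 1 < α) :
    Integrable (fun x => x) (ProbabilityTheory.paretoMeasure c α) := by
  rw [ProbabilityTheory.paretoMeasure, integrable_withDensity_iff
    (f := ProbabilityTheory.paretoPDF c α) (ProbabilityTheory.measurable_paretoPDFReal c α).ennreal_ofReal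
    (Filter.Eventually.of_forall fun x => ENNReal.ofReal_lt_top)]
  have h1 : IntegrableOn (fun x : ℝ => α * c ^ α * x ^ (-α)) (Set.Ici c) := by
    rw [integrableOn_Ici_iff_integrableOn_Ioi]
    exact (integrableOn_Ioi_rpow_of_lt (by linarith) hc).const_mul _
  rw [← integrable_indicator_iff measurableSet_Ici] at h1
  refine h1.congr (Filter.Eventually.of_forall fun x => ?_)
  simp only
  rw [ProbabilityTheory.paretoPDF,
    ENNReal.toReal_ofReal (ProbabilityTheory.paretoPDFReal_nonneg hc.le (by linarith) x)]
  by_cases h : c ≤ x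
  · have hx := hc.trans_le h
    rw [Set.indicator_of_mem (by exact h), ProbabilityTheory.paretoPDFReal, if_pos h]
    have : x ^ (-α) = x * x ^ (-(α + 1)) := by
      rw [← Real.rpow_one_add' hx.le (by linarith)]; congr 1; ring
    rw [this]; ring
  · rw [Set.indicator_of_notMem (by exact h), ProbabilityTheory.paretoPDFReal, if_neg h]
    simp

/-- For `X` Pareto distributed with scale `x_m > 0` and shape `α > 1`, the distance
variance is `4α²x_m² / ((α-1)(2α-1)²(3α-2))`. -/
theorem distVar_pareto (xm α : ℝ) (hxm : 0 < xm) (hα : 1 < α) :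
    distVar (ProbabilityTheory.paretoMeasure xm α) =
      4 * α ^ 2 * xm ^ 2 / ((α - 1) * (2 * α - 1) ^ 2 * (3 * α - 2)) := by
  have hP := ProbabilityTheory.isProbabilityMeasure_paretoMeasure hxm (by linarith : 0 < α)
  have hcm := charF_meas (ProbabilityTheory.paretoMeasure xm α)
  rw [distVar, integral_eq_lintegral_of_nonneg_ae (Filter.Eventually.of_forall fun q => by
      simp only [Pi.zero_apply]; positivity)
    (Measurable.aestronglyMeasurable (by fun_prop)),
    distVar_lint _ (pareto_pos xm α hxm) (pareto_int xm α hxm hα)]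
  simp_rw [pareto_tail xm α _ hxm hα]
  have h1 : 0 < α - 1 := by linarith
  have h2 : 0 < 2 * α - 1 := by linarith
  have h3 : 0 < 3 * α - 2 := by linarith
  rw [outer_lint xm α hxm hα, ENNReal.toReal_mul, ENNReal.toReal_mul,
    ENNReal.toReal_ofReal (by positivity), ENNReal.toReal_ofReal (by positivity)]
  have := Real.pi_ne_zero
  generalize (α - 1) * (2 * α - 1) ^ 2 * (3 * α - 2) = D
  field_simp
  norm_num
end

section
/- Let X be Bernoulli(1/2) and Y uniform on [0,1], independent of X. Then V^2(X) = 1/4 > 8/45 = V^2(X+Y); i.e., adding independent noise can strictly decrease the distance variance. -/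
open MeasureTheory

/-- The Bernoulli distribution with parameter `p`, as a measure on `ℝ`. -/
noncomputable def bern (p : ℝ) : Measure ℝ :=
  ENNReal.ofReal p • Measure.dirac 1 + ENNReal.ofReal (1 - p) • Measure.dirac 0

/-- The uniform distribution on the interval `[a, b]`, as a measure on `ℝ`. -/
noncomputable def unif (a b : ℝ) : Measure ℝ :=
  (ENNReal.ofReal (b - a))⁻¹ • volume.restrict (Set.Icc a b)


open FourierTransform SchwartzMap in
theorem plancherel_aux_s18 {E : Type*} [NormedAddCommGroup E] [InnerProductSpace ℝ E]
    [FiniteDimensional ℝ E] [MeasurableSpace E] [BorelSpace E] (f : E → ℂ)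
    (h1 : Integrable f) (h2 : MemLp f 2) :
    ∫ w, ‖𝓕 f w‖ ^ 2 = ∫ v, ‖f v‖ ^ 2 := by
  set g : Lp (α := E) ℂ 2 volume := h2.toLp f with hg
  have hae : ∀ᵐ x, (𝓕 g : Lp (α := E) ℂ 2 volume) x = 𝓕 f x := by
    apply ae_eq_of_integral_contDiff_smul_eq
    · exact (Lp.memLp _).locallyIntegrable (by norm_num)
    · exact (VectorFourier.fourierIntegral_continuous Real.continuous_fourierChar
        (L := innerₗ E) continuous_inner h1).locallyIntegrable
    · intro φ φs φc
      have hg₁ : HasCompactSupport (Complex.ofRealCLM ∘ φ) := φc.comp_left rfl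
      have hg₂ : ContDiff ℝ (⊤ : ℕ∞) (Complex.ofRealCLM ∘ φ) := by fun_prop
      set ψ := hg₁.toSchwartzMap hg₂ with hψ
      have e1 := congrArg (fun T => T ψ) (Lp.fourier_toTemperedDistribution_eq g)
      simp only [TemperedDistribution.fourier_apply, Lp.toTemperedDistribution_apply] at e1
      have e2 : ∫ x, 𝓕 ψ x • f x = ∫ x, ψ x • 𝓕 f x := by
        simpa using! VectorFourier.integral_fourierIntegral_smul_eq_flip (L := innerₗ E)
          Real.continuous_fourierChar continuous_inner ψ.integrable h1
      have e3 : ∫ x, 𝓕 ψ x • g x = ∫ x, 𝓕 ψ x • f x := by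
        apply integral_congr_ae
        filter_upwards [h2.coeFn_toLp] with x hx
        rw [hx]
      have := e1.symm.trans (e3.trans e2)
      simpa [hψ] using this
  have key : ∀ h : Lp (α := E) ℂ 2 volume, ∫ v, ‖h v‖ ^ 2 = ‖h‖ ^ 2 := by
    intro h
    have := L2.inner_def (𝕜 := ℂ) h h
    rw [inner_self_eq_norm_sq_to_K] at this
    simp only [inner_self_eq_norm_sq_to_K] at this
    have h' : ((‖h‖ ^ 2 : ℝ) : ℂ) = ((∫ v, ‖h v‖ ^ 2 : ℝ) : ℂ) := by
      rw [← integral_complex_ofReal]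
      simpa using this
    exact_mod_cast h'.symm
  have a1 : ∫ w, ‖𝓕 f w‖ ^ 2 = ∫ w, ‖(𝓕 g : Lp (α := E) ℂ 2 volume) w‖ ^ 2 := by
    apply integral_congr_ae
    filter_upwards [hae] with x hx
    rw [hx]
  have a2 : ∫ w, ‖f w‖ ^ 2 = ∫ w, ‖g w‖ ^ 2 := by
    apply integral_congr_ae
    filter_upwards [h2.coeFn_toLp] with x hx
    rw [hx]
  rw [a1, a2, key, key, Lp.norm_fourier_eq]

open FourierTransform in
theorem plancherel_prod (f : ℝ × ℝ → ℂ) (h1 : Integrable f) (h2 : MemLp f 2) :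
    ∫ q : ℝ × ℝ, ‖∫ p : ℝ × ℝ, Complex.exp ((q.1 * p.1 + q.2 * p.2 : ℝ) * Complex.I) * f p‖ ^ 2
      = (2 * Real.pi) ^ 2 * ∫ p, ‖f p‖ ^ 2 := by
  have mp := WithLp.volume_preserving_symm_measurableEquiv_toLp_prod ℝ ℝ
  set e := (MeasurableEquiv.toLp 2 (ℝ × ℝ)).symm with he
  have me := e.measurableEmbedding
  have P := plancherel_aux_s18 (fun v => f (e v)) ((mp.integrable_comp_emb me).2 h1)
    (h2.comp_measurePreserving mp)
  rw [mp.integral_comp me (fun p => ‖f p‖ ^ 2)] at P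
  set G : ℝ × ℝ → ℝ := fun q =>
    ‖∫ p : ℝ × ℝ, Complex.exp ((q.1 * p.1 + q.2 * p.2 : ℝ) * Complex.I) * f p‖ ^ 2 with hG
  have hF : ∀ w, ‖𝓕 (fun v => f (e v)) w‖ ^ 2 = G ((-(2 * Real.pi)) • e w) := by
    intro w
    rw [Real.fourier_eq', hG]
    simp only
    congr 2
    rw [← mp.integral_comp me]
    apply integral_congr_ae
    filter_upwards with v
    rw [smul_eq_mul]
    congr 4
    simp [he, WithLp.prod_inner_apply]
    ring
  simp_rw [hF] at P
  rw [mp.integral_comp me (fun q => G ((-(2 * Real.pi)) • q)), Measure.integral_comp_smul] at P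
  rw [← P]
  have : Real.pi ≠ 0 := Real.pi_ne_zero
  simp
  field_simp
  rw [sq_abs]

theorem plancherel_rect (a : ℝ) (ha : 0 ≤ a) (k : ℝ × ℝ → ℝ) (hk : Continuous k) :
    ∫ q : ℝ × ℝ, ‖∫ x in (0:ℝ)..a, ∫ y in (0:ℝ)..a,
        Complex.exp ((q.1 * x + q.2 * y : ℝ) * Complex.I) * (k (x, y) : ℂ)‖ ^ 2
      = (2 * Real.pi) ^ 2 * ∫ x in (0:ℝ)..a, ∫ y in (0:ℝ)..a, k (x, y) ^ 2 := by
  set S : Set (ℝ × ℝ) := Set.Ioc 0 a ×ˢ Set.Ioc 0 a with hS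
  have mS : MeasurableSet S := measurableSet_Ioc.prod measurableSet_Ioc
  have hfin : IsFiniteMeasure (volume.restrict S) := by
    refine ⟨?_⟩
    rw [Measure.restrict_apply_univ]
    refine lt_of_le_of_lt (measure_mono (Set.prod_mono Set.Ioc_subset_Icc_self Set.Ioc_subset_Icc_self)) ?_
    exact (isCompact_Icc.prod isCompact_Icc).measure_lt_top
  have int : ∀ {F : Type} [NormedAddCommGroup F] (g : ℝ × ℝ → F), Continuous g →
      IntegrableOn g S volume := by
    intro F _ g hg
    refine (hg.continuousOn.integrableOn_compact (isCompact_Icc.prod isCompact_Icc)).mono_set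
      (Set.prod_mono Set.Ioc_subset_Icc_self Set.Ioc_subset_Icc_self)
  have hkc : Continuous (fun p => (k p : ℂ)) := Complex.continuous_ofReal.comp hk
  have h1 : Integrable (S.indicator (fun p => (k p : ℂ))) := (int _ hkc).integrable_indicator mS
  have h2 : MemLp (S.indicator (fun p => (k p : ℂ))) 2 := by
    rw [memLp_indicator_iff_restrict mS, memLp_two_iff_integrable_sq_norm hkc.aestronglyMeasurable]
    exact int _ (by fun_prop)
  have fub : ∀ {F : Type} [NormedAddCommGroup F] [NormedSpace ℝ F] (g : ℝ × ℝ → F), Continuous g →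
      ∫ p in S, g p = ∫ x in (0:ℝ)..a, ∫ y in (0:ℝ)..a, g (x, y) := by
    intro F _ _ g hg
    simp_rw [intervalIntegral.integral_of_le ha]
    exact setIntegral_prod g (int g hg)
  have P := plancherel_prod _ h1 h2
  have r : ∫ p, ‖S.indicator (fun p => (k p : ℂ)) p‖ ^ 2 
      = ∫ x in (0:ℝ)..a, ∫ y in (0:ℝ)..a, k (x, y) ^ 2 := by
    rw [← fub (fun p => k p ^ 2) (by fun_prop), ← integral_indicator mS]
    congr 1; ext p
    by_cases hp : p ∈ S <;> simp [hp]
  rw [r] at P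
  rw [← P]
  congr 1; ext q
  congr 2
  rw [← fub (fun p => Complex.exp ((q.1 * p.1 + q.2 * p.2 : ℝ) * Complex.I) * (k p : ℂ))
    (by fun_prop), ← integral_indicator mS]
  congr 1; ext p
  by_cases hp : p ∈ S <;> simp [hp]

theorem charF_bern (t : ℝ) : charF (bern (1 / 2)) t = (Complex.exp (t * Complex.I) + 1) / 2 := by
  unfold charF bern
  rw [integral_add_measure, integral_smul_measure, integral_smul_measure, integral_dirac,
    integral_dirac]
  · rw [ENNReal.toReal_ofReal (by norm_num), ENNReal.toReal_ofReal (by norm_num)]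
    simp only [Complex.real_smul]
    push_cast
    simp
    ring
  · exact (integrable_dirac (by simp)).smul_measure (by simp)
  · exact (integrable_dirac (by simp)).smul_measure (by simp)

theorem exp_int (t a : ℝ) (ht : t ≠ 0) :
    ∫ x in (0:ℝ)..a, Complex.exp ((t * x : ℝ) * Complex.I)
      = (Complex.exp ((t * a : ℝ) * Complex.I) - 1) / (t * Complex.I) := by
  have h := integral_exp_mul_complex (a := 0) (b := a) (c := t * Complex.I)
    (by simp [ht])
  have e : ∀ x : ℝ, ((t * x : ℝ) * Complex.I : ℂ) = t * Complex.I * x := by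
    intro x; push_cast; ring
  simp_rw [e, h]
  simp

theorem charF_unif (t : ℝ) (ht : t ≠ 0) :
    charF (unif 0 1) t = (Complex.exp (t * Complex.I) - 1) / (t * Complex.I) := by
  have h := exp_int t 1 ht
  rw [intervalIntegral.integral_of_le zero_le_one] at h
  unfold charF unif
  rw [integral_smul_measure, integral_Icc_eq_integral_Ioc, h]
  simp

instance : IsFiniteMeasure (bern (1 / 2)) := by
  unfold bern
  refine ⟨?_⟩
  simp

instance : IsFiniteMeasure (unif 0 1) := by
  unfold unif
  refine ⟨?_⟩
  simp

theorem charF_sum (t : ℝ) (ht : t ≠ 0) :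
    charF (((bern (1 / 2)).prod (unif 0 1)).map (fun q => q.1 + q.2)) t =
      (Complex.exp (2 * t * Complex.I) - 1) / (2 * t * Complex.I) := by
  have h : charF (((bern (1 / 2)).prod (unif 0 1)).map (fun q => q.1 + q.2)) t
      = charF (bern (1 / 2)) t * charF (unif 0 1) t := by
    unfold charF
    rw [integral_map (by fun_prop) (by fun_prop), ← integral_prod_mul]
    congr 1; ext q
    rw [← Complex.exp_add]
    congr 1; push_cast; ring
  rw [h, charF_bern, charF_unif t ht]
  have e : Complex.exp (2 * t * Complex.I) = Complex.exp (t * Complex.I) ^ 2 := by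
    rw [← Complex.exp_nat_mul]; congr 1; push_cast; ring
  rw [e]
  have : (t : ℂ) ≠ 0 := by exact_mod_cast ht
  have := Complex.I_ne_zero
  field_simp
  ring

theorem ae_ne (L : ℝ × ℝ →ₗ[ℝ] ℝ) (hL : L ≠ 0) : ∀ᵐ q : ℝ × ℝ, L q ≠ 0 := by
  have h := Measure.addHaar_submodule (volume : Measure (ℝ × ℝ)) (LinearMap.ker L)
    (by simpa using hL)
  rw [ae_iff]
  simpa [LinearMap.mem_ker] using! h

theorem ae_good : ∀ᵐ q : ℝ × ℝ, q.1 ≠ 0 ∧ q.2 ≠ 0 ∧ q.1 + q.2 ≠ 0 := by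
  have h1 := ae_ne (LinearMap.fst ℝ ℝ ℝ) (fun h => by simpa using congrArg (fun L => L (1, 0)) h)
  have h2 := ae_ne (LinearMap.snd ℝ ℝ ℝ) (fun h => by simpa using congrArg (fun L => L (0, 1)) h)
  have h3 := ae_ne (LinearMap.fst ℝ ℝ ℝ + LinearMap.snd ℝ ℝ ℝ)
    (fun h => by simpa using congrArg (fun L => L (0, 1)) h)
  filter_upwards [h1, h2, h3] with q a b c
  exact ⟨a, b, c⟩

theorem distVar_of_kernel (μ : Measure ℝ) (a : ℝ) (ha : 0 ≤ a) (k : ℝ × ℝ → ℝ) (hk : Continuous k)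
    (H : ∀ s t : ℝ, s ≠ 0 → t ≠ 0 → s + t ≠ 0 →
      charF μ (s + t) - charF μ s * charF μ t = -(s * t) * ∫ x in (0:ℝ)..a, ∫ y in (0:ℝ)..a,
        Complex.exp ((s * x + t * y : ℝ) * Complex.I) * (k (x, y) : ℂ)) :
    distVar μ = 4 * ∫ x in (0:ℝ)..a, ∫ y in (0:ℝ)..a, k (x, y) ^ 2 := by
  have P := plancherel_rect a ha k hk
  unfold distVar
  have : ∫ q : ℝ × ℝ, ‖charF μ (q.1 + q.2) - charF μ q.1 * charF μ q.2‖ ^ 2 / (q.1 ^ 2 * q.2 ^ 2)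
      = ∫ q : ℝ × ℝ, ‖∫ x in (0:ℝ)..a, ∫ y in (0:ℝ)..a,
        Complex.exp ((q.1 * x + q.2 * y : ℝ) * Complex.I) * (k (x, y) : ℂ)‖ ^ 2 := by
    apply integral_congr_ae
    filter_upwards [ae_good] with q hq
    obtain ⟨h1, h2, h3⟩ := hq
    rw [H _ _ h1 h2 h3, norm_mul, norm_neg, norm_mul, Complex.norm_real, Complex.norm_real,
      mul_pow, mul_pow, Real.norm_eq_abs, Real.norm_eq_abs, sq_abs, sq_abs]
    exact mul_div_cancel_left₀ _ (mul_ne_zero (pow_ne_zero 2 h1) (pow_ne_zero 2 h2))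
  rw [this, P]
  have := Real.pi_ne_zero
  field_simp
  ring

theorem distVar_bern : distVar (bern (1 / 2)) = 1 / 4 := by
  rw [distVar_of_kernel _ 1 zero_le_one (fun _ => 1 / 4) continuous_const]
  · simp; norm_num
  intro s t hs ht _
  have e : ∀ x y : ℝ, Complex.exp ((s * x + t * y : ℝ) * Complex.I) * ((1 / 4 : ℝ) : ℂ)
      = (Complex.exp ((s * x : ℝ) * Complex.I) * (1 / 4)) *
        Complex.exp ((t * y : ℝ) * Complex.I) := by
    intro x y
    push_cast
    rw [add_mul, Complex.exp_add]
    ring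
  simp_rw [e, intervalIntegral.integral_const_mul, intervalIntegral.integral_mul_const]
  rw [exp_int s 1 hs, exp_int t 1 ht, charF_bern, charF_bern, charF_bern]
  have e2 : Complex.exp ((s + t : ℝ) * Complex.I)
      = Complex.exp (s * Complex.I) * Complex.exp (t * Complex.I) := by
    push_cast
    rw [add_mul, Complex.exp_add]
  rw [e2]
  have h1 : (s : ℂ) ≠ 0 := by exact_mod_cast hs
  have h2 : (t : ℂ) ≠ 0 := by exact_mod_cast ht
  have := Complex.I_ne_zero
  have := Complex.I_sq
  simp only [mul_one]
  field_simp
  rw [Complex.I_sq]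
  ring

/-- antiderivative of `(a + b x) e^{cx}` -/
theorem lin_exp_int (a b c : ℂ) (hc : c ≠ 0) (u v : ℝ) :
    ∫ x in u..v, (a + b * x) * Complex.exp (c * x) =
      ((a + b * v) / c - b / c ^ 2) * Complex.exp (c * v) -
      ((a + b * u) / c - b / c ^ 2) * Complex.exp (c * u) := by
  have hd : ∀ x : ℝ, HasDerivAt (fun x : ℝ =>
      ((a + b * x) / c - b / c ^ 2) * Complex.exp (c * x))
      ((a + b * x) * Complex.exp (c * x)) x := by
    intro x
    have h0 : HasDerivAt (fun x : ℝ => (x : ℂ)) 1 x := Complex.ofRealCLM.hasDerivAt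
    have h1 := ((((h0.const_mul b).const_add a).div_const c).sub_const (b / c ^ 2)).mul
      ((h0.const_mul c).cexp)
    convert! h1 using 1
    field_simp
    ring
  exact intervalIntegral.integral_eq_sub_of_hasDerivAt (fun x _ => hd x)
    (Continuous.intervalIntegrable (by fun_prop) _ _)

/-- kernel for the uniform law on `[0,2]` -/
noncomputable def kU (p : ℝ × ℝ) : ℝ := min p.1 p.2 / 2 * (1 - max p.1 p.2 / 2)

theorem kU_cont : Continuous kU := by unfold kU; fun_prop

theorem kU_sq_int : ∫ x in (0:ℝ)..2, ∫ y in (0:ℝ)..2, kU (x, y) ^ 2 = 2 / 45 := by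
  have inner : ∀ x ∈ Set.uIcc (0:ℝ) 2, ∫ y in (0:ℝ)..2, kU (x, y) ^ 2
      = (1 - x / 2) ^ 2 / 4 * x ^ 3 / 3 + x ^ 2 / 4 * (2 / 3 * (1 - x / 2) ^ 3) := by
    intro x hx
    rw [Set.uIcc_of_le (by norm_num)] at hx
    have hc : Continuous fun y => kU (x, y) ^ 2 := (kU_cont.comp (by fun_prop)).pow 2
    rw [← intervalIntegral.integral_add_adjacent_intervals (b := x)
      (hc.intervalIntegrable _ _) (hc.intervalIntegrable _ _)]
    have i1 : ∫ y in (0:ℝ)..x, kU (x, y) ^ 2 = ∫ y in (0:ℝ)..x, (1 - x / 2) ^ 2 / 4 * y ^ 2 := by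
      apply intervalIntegral.integral_congr
      intro y hy
      rw [Set.uIcc_of_le hx.1] at hy
      simp only [kU, min_eq_right hy.2, max_eq_left hy.2]
      ring
    have i2 : ∫ y in x..2, kU (x, y) ^ 2 = 
        ∫ y in x..2, (x ^ 2 / 4 - x ^ 2 / 4 * y ^ 1 + x ^ 2 / 16 * y ^ 2) := by
      apply intervalIntegral.integral_congr
      intro y hy
      rw [Set.uIcc_of_le hx.2] at hy
      simp only [kU, min_eq_left hy.1, max_eq_right hy.1]
      ring
    rw [i1, i2, intervalIntegral.integral_add, intervalIntegral.integral_sub]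
    · simp only [intervalIntegral.integral_const_mul, integral_pow,
        intervalIntegral.integral_const, smul_eq_mul]
      norm_num
      ring
    all_goals exact Continuous.intervalIntegrable (by fun_prop) _ _
  rw [intervalIntegral.integral_congr inner]
  have e : ∀ x : ℝ, (1 - x / 2) ^ 2 / 4 * x ^ 3 / 3 + x ^ 2 / 4 * (2 / 3 * (1 - x / 2) ^ 3)
     = 1 / 6 * x ^ 2 - 1 / 6 * x ^ 3 + 1 / 24 * x ^ 4 := by intro x; ring
  simp_rw [e]
  rw [intervalIntegral.integral_add, intervalIntegral.integral_sub]
  · simp only [intervalIntegral.integral_const_mul, integral_pow]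
    norm_num
  all_goals exact Continuous.intervalIntegrable (by fun_prop) _ _

theorem kU_inner (t x : ℝ) (ht : t ≠ 0) (hx : x ∈ Set.Icc (0:ℝ) 2) :
    ∫ y in (0:ℝ)..2, Complex.exp (t * Complex.I * y) * (kU (x, y) : ℂ)
      = (Complex.exp (t * Complex.I * x) - 1
          - x / 2 * (Complex.exp (t * Complex.I * 2) - 1)) / (2 * t ^ 2) := by
  have h1 : (t : ℂ) ≠ 0 := by exact_mod_cast ht
  have hI := Complex.I_ne_zero
  have hc : Continuous fun y : ℝ => Complex.exp (t * Complex.I * y) * (kU (x, y) : ℂ) := by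
    have : Continuous fun y : ℝ => kU (x, y) := kU_cont.comp (by fun_prop)
    fun_prop
  rw [← intervalIntegral.integral_add_adjacent_intervals (b := x)
      (hc.intervalIntegrable _ _) (hc.intervalIntegrable _ _)]
  have i1 : ∫ y in (0:ℝ)..x, Complex.exp (t * Complex.I * y) * (kU (x, y) : ℂ)
      = ∫ y in (0:ℝ)..x, (0 + (1 - x / 2) / 2 * y) * Complex.exp (t * Complex.I * y) := by
    apply intervalIntegral.integral_congr
    intro y hy
    rw [Set.uIcc_of_le hx.1] at hy
    simp only [kU, min_eq_right hy.2, max_eq_left hy.2]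
    push_cast
    ring
  have i2 : ∫ y in x..2, Complex.exp (t * Complex.I * y) * (kU (x, y) : ℂ)
      = ∫ y in x..2, (x / 2 + (-(x / 4)) * y) * Complex.exp (t * Complex.I * y) := by
    apply intervalIntegral.integral_congr
    intro y hy
    rw [Set.uIcc_of_le hx.2] at hy
    simp only [kU, min_eq_left hy.1, max_eq_right hy.1]
    push_cast
    ring
  rw [i1, i2, lin_exp_int _ _ _ (mul_ne_zero h1 hI), lin_exp_int _ _ _ (mul_ne_zero h1 hI)]
  generalize Complex.exp (t * Complex.I * x) = A
  push_cast
  generalize Complex.exp (t * Complex.I * 2) = B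
  simp only [mul_zero, Complex.exp_zero, mul_pow, Complex.I_sq]
  field_simp
  ring

theorem distVar_sum :
    distVar (((bern (1 / 2)).prod (unif 0 1)).map (fun q => q.1 + q.2)) = 8 / 45 := by
  rw [distVar_of_kernel _ 2 zero_le_two kU kU_cont, kU_sq_int]
  · norm_num
  intro s t hs ht hst
  rw [charF_sum _ hs, charF_sum _ ht, charF_sum _ hst]
  have h1 : (s : ℂ) ≠ 0 := by exact_mod_cast hs
  have h2 : (t : ℂ) ≠ 0 := by exact_mod_cast ht
  have h3 : (s + t : ℂ) ≠ 0 := by exact_mod_cast hst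
  have hI := Complex.I_ne_zero
  have e : ∀ x ∈ Set.uIcc (0:ℝ) 2, ∫ y in (0:ℝ)..2,
      Complex.exp ((s * x + t * y : ℝ) * Complex.I) * (kU (x, y) : ℂ)
      = (1 / (2 * t ^ 2) + 0 * x) * Complex.exp ((s + t) * Complex.I * x)
        + (-1 / (2 * t ^ 2) + (-(Complex.exp (t * Complex.I * 2) - 1) / (4 * t ^ 2)) * x)
          * Complex.exp (s * Complex.I * x) := by
    intro x hx
    rw [Set.uIcc_of_le zero_le_two] at hx
    have e1 : ∀ y : ℝ, Complex.exp ((s * x + t * y : ℝ) * Complex.I) * (kU (x, y) : ℂ)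
        = Complex.exp (s * Complex.I * x) *
          (Complex.exp (t * Complex.I * y) * (kU (x, y) : ℂ)) := by
      intro y
      rw [← mul_assoc, ← Complex.exp_add]
      congr 2; push_cast; ring
    simp_rw [e1, intervalIntegral.integral_const_mul]
    rw [kU_inner t x ht hx]
    have e2 : Complex.exp ((s + t) * Complex.I * x)
        = Complex.exp (s * Complex.I * x) * Complex.exp (t * Complex.I * x) := by
      rw [← Complex.exp_add]; congr 1; ring
    rw [e2]
    field_simp
    ring
  rw [intervalIntegral.integral_congr e, intervalIntegral.integral_add
    (Continuous.intervalIntegrable (by fun_prop) _ _)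
    (Continuous.intervalIntegrable (by fun_prop) _ _),
    lin_exp_int _ _ _ (mul_ne_zero h3 hI), lin_exp_int _ _ _ (mul_ne_zero h1 hI)]
  have e2 : Complex.exp ((s + t) * Complex.I * 2)
        = Complex.exp (s * Complex.I * 2) * Complex.exp (t * Complex.I * 2) := by
      rw [← Complex.exp_add]; congr 1; ring
  have e3 : Complex.exp (2 * ((s + t : ℝ) : ℂ) * Complex.I)
        = Complex.exp (s * Complex.I * 2) * Complex.exp (t * Complex.I * 2) := by
      rw [← Complex.exp_add]; congr 1; push_cast; ring
  have e4 : ∀ s : ℂ, 2 * s * Complex.I = s * Complex.I * 2 := by intro s; ring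
  rw [e3, e4 s, e4 t]
  push_cast
  rw [e2]
  generalize Complex.exp (s * Complex.I * 2) = A
  generalize Complex.exp (t * Complex.I * 2) = B
  simp only [mul_zero, Complex.exp_zero, mul_pow, Complex.I_sq]
  field_simp
  ring_nf
  simp only [Complex.I_sq]
  ring

/-- For `X` Bernoulli(1/2) and `Y` uniform on `[0,1]` independent of `X`:
`V²(X) = 1/4 > 8/45 = V²(X+Y)`; adding independent noise can decrease distance variance. -/
theorem distVar_add_noise_decrease :
    distVar (bern (1 / 2)) = 1 / 4 ∧
      distVar (((bern (1 / 2)).prod (unif 0 1)).map (fun q => q.1 + q.2)) = 8 / 45 ∧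
      distVar (((bern (1 / 2)).prod (unif 0 1)).map (fun q => q.1 + q.2)) <
        distVar (bern (1 / 2)) := by
  refine ⟨distVar_bern, distVar_sum, ?_⟩
  rw [distVar_bern, distVar_sum]
  norm_num
end
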